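/- Let H = kQ be a representation-finite hereditary algebra over an algebraically closed field whose underlying graph is the Dynkin diagram D_n (n ≥ 4). Then the nilpotency index of the radical of mod H equals 2n − 3. -/

import Mathlib

open CategoryTheory
open scoped Classical

/-! ## Quiver combinatorics -/

/-- Paths in a quiver given by source and target maps. -/
inductive QPath {V E : Type} (src tgt : E → V) : V → V → Type
  | nil (a : V) : QPath src tgt a a
  | cons {a b : V} (p : QPath src tgt a b) (α : E) (h : src α = b) : QPath src tgt a (tgt α)

namespace QPath

variable {V E : Type} {src tgt : E → V}

def length : ∀ {a b : V}, QPath src tgt a b → ℕ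
  | _, _, .nil _ => 0
  | _, _, .cons p _ _ => p.length + 1

def comp : ∀ {a b c : V}, QPath src tgt a b → QPath src tgt b c → QPath src tgt a c
  | _, _, _, p, .nil _ => p
  | _, _, _, p, .cons q α h => .cons (p.comp q) α h

/-- The list of vertices visited by a path, in order. -/
def verts : ∀ {a b : V}, QPath src tgt a b → List V
  | a, _, .nil _ => [a]
  | _, _, .cons p α _ => p.verts ++ [tgt α]

/-- The interior (intermediate) vertices of a path. -/
def interior {a b : V} (p : QPath src tgt a b) : List V :=
  (p.verts.dropLast).drop 1

/-- The list of arrows of a path, in walk order. -/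
def arrows : ∀ {a b : V}, QPath src tgt a b → List E
  | _, _, .nil _ => []
  | _, _, .cons p α _ => p.arrows ++ [α]

end QPath

/-- A presentation of the algebra `A` by the (ordinary) quiver with vertex set `V`
and arrow set `E` : a complete family of orthogonal primitive idempotents indexed by
the vertices together with generators indexed by the arrows. -/
structure QuiverPresentation (k A V E : Type) [Field k] [Ring A] [Algebra k A]
    [Fintype V] [Fintype E] where
  src : E → V
  tgt : E → V
  idem : V → A
  arrow : E → A
  idem_idem : ∀ a : V, idem a * idem a = idem a
  idem_orth : ∀ a b : V, a ≠ b → idem a * idem b = 0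
  sum_idem : ∑ a : V, idem a = 1
  idem_ne : ∀ a : V, idem a ≠ 0
  idem_primitive : ∀ (v : V) (f g : A), f * f = f → g * g = g → f * g = 0 → g * f = 0 →
    f + g = idem v → f = 0 ∨ g = 0
  arrow_mem : ∀ α : E, idem (tgt α) * arrow α * idem (src α) = arrow α
  arrow_ne : ∀ α : E, arrow α ≠ 0
  generates : Algebra.adjoin k (Set.range idem ∪ Set.range arrow) = ⊤

namespace QuiverPresentation

variable {k A V E : Type} [Field k] [Ring A] [Algebra k A] [Fintype V] [Fintype E]

/-- The product in `A` of the arrows along a path (paths are written right to left). -/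
def qprod (P : QuiverPresentation k A V E) :
    ∀ {a b : V}, QPath P.src P.tgt a b → A
  | _, _, .nil a => P.idem a
  | _, _, .cons p α _ => P.arrow α * P.qprod p

/-- The ideal of relations is admissible: all sufficiently long paths vanish. -/
def Admissible (P : QuiverPresentation k A V E) : Prop :=
  ∃ N : ℕ, ∀ (a b : V) (p : QPath P.src P.tgt a b), N ≤ p.length → P.qprod p = 0

/-- The presentation is minimal: the idempotents and the arrows are linearly
independent modulo the span of the products of paths of length at least two,
so that `(V, E)` really is the ordinary quiver of `A`. -/
def Minimal (P : QuiverPresentation k A V E) : Prop :=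
  ∀ (c : V → k) (d : E → k),
    ((∑ a : V, c a • P.idem a) + ∑ α : E, d α • P.arrow α) ∈
      Submodule.span k {x : A | ∃ (a b : V) (p : QPath P.src P.tgt a b),
        2 ≤ p.length ∧ P.qprod p = x} →
    (∀ a, c a = 0) ∧ (∀ α, d α = 0)

/-- The algebra is monomial: the ideal of relations is generated by paths; equivalently,
the images of the paths which do not vanish are linearly independent. -/
def Monomial (P : QuiverPresentation k A V E) : Prop :=
  LinearIndependent k
    (fun q : {q : Σ a : V, Σ b : V, QPath P.src P.tgt a b // P.qprod q.2.2 ≠ 0} =>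
      P.qprod q.1.2.2)

/-- A (minimal) zero-relation: a path of length at least two whose product vanishes
while the product along every proper subpath does not. -/
def IsZeroRel (P : QuiverPresentation k A V E) {a b : V} (p : QPath P.src P.tgt a b) : Prop :=
  P.qprod p = 0 ∧ 2 ≤ p.length ∧
  ∀ (x y : V) (q : QPath P.src P.tgt x y) (p₁ : QPath P.src P.tgt a x)
    (p₂ : QPath P.src P.tgt y b),
      p = p₁.comp (q.comp p₂) → q.length < p.length → P.qprod q ≠ 0

/-- A vertex `u` is involved in a zero-relation `α_m ⋯ α_1` if `u = s(α_i)`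
for some `i = 2, …, m`, i.e. `u` is an interior vertex of the relation. -/
def InvolvedInZeroRel (P : QuiverPresentation k A V E) (u : V) : Prop :=
  ∃ (a b : V) (p : QPath P.src P.tgt a b), P.IsZeroRel p ∧ u ∈ p.interior

/-! ### Walks (for strings and for connectivity) -/

/-- The starting vertex of a step (an arrow traversed forwards or backwards). -/
def stepSrc (P : QuiverPresentation k A V E) (s : E × Bool) : V :=
  if s.2 then P.src s.1 else P.tgt s.1

/-- The ending vertex of a step. -/
def stepTgt (P : QuiverPresentation k A V E) (s : E × Bool) : V :=
  if s.2 then P.tgt s.1 else P.src s.1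

/-- `l` is a walk from `a` to `b` in the underlying graph of the quiver. -/
def IsWalkFrom (P : QuiverPresentation k A V E) : V → List (E × Bool) → V → Prop
  | a, [], b => a = b
  | a, s :: l, b => P.stepSrc s = a ∧ P.IsWalkFrom (P.stepTgt s) l b

/-- The product in `A` of a list of arrows (listed in walk order). -/
def wprod (P : QuiverPresentation k A V E) (l : List E) : A :=
  ((l.map P.arrow).reverse).prod

/-- A reduced walk: no step is immediately followed by its inverse. -/
def Reduced (l : List (E × Bool)) : Prop :=
  ¬ ∃ (l₁ : List (E × Bool)) (s : E × Bool) (l₂ : List (E × Bool)),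
      l = l₁ ++ s :: (s.1, !s.2) :: l₂

/-- No direct subwalk of `l` nor the inverse of such lies in the ideal of relations. -/
def NoZeroSub (P : QuiverPresentation k A V E) (l : List (E × Bool)) : Prop :=
  ∀ (l₁ : List (E × Bool)) (r : List E) (l₂ : List (E × Bool)),
    (l = l₁ ++ (r.map (fun e => (e, true))) ++ l₂ → P.wprod r ≠ 0) ∧
    (l = l₁ ++ (r.map (fun e => (e, false))) ++ l₂ → P.wprod r.reverse ≠ 0)

/-- A string from `a` to `b`. -/
def IsStringWalk (P : QuiverPresentation k A V E) (a : V) (l : List (E × Bool)) (b : V) : Prop :=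
  P.IsWalkFrom a l b ∧ Reduced l ∧ P.NoZeroSub l

/-- `(Q_u^s)_0` : the strings starting at `u` that are trivial or start with an arrow. -/
def QSset (P : QuiverPresentation k A V E) (u : V) : Set (List (E × Bool)) :=
  {l | ∃ b : V, P.IsStringWalk u l b ∧ (l = [] ∨ ∃ (α : E) (l' : List (E × Bool)),
    l = (α, true) :: l')}

/-- `(Q_u^e)_0` : the strings ending at `u` that are trivial or end with an arrow. -/
def QEset (P : QuiverPresentation k A V E) (u : V) : Set (List (E × Bool)) :=
  {l | ∃ a : V, P.IsStringWalk a l u ∧ (l = [] ∨ ∃ (α : E) (l' : List (E × Bool)),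
    l = l' ++ [(α, true)])}

/-- `S_γ` : the strings starting with the arrow `γ`. -/
def Sarr (P : QuiverPresentation k A V E) (γ : E) : Set (List (E × Bool)) :=
  {l | ∃ b : V, P.IsStringWalk (P.src γ) l b ∧ ∃ l' : List (E × Bool), l = (γ, true) :: l'}

/-- `E_γ` : the strings ending with the arrow `γ`. -/
def Earr (P : QuiverPresentation k A V E) (γ : E) : Set (List (E × Bool)) :=
  {l | ∃ a : V, P.IsStringWalk a l (P.tgt γ) ∧ ∃ l' : List (E × Bool), l = l' ++ [(γ, true)]}

/-- The defining conditions of a string algebra. -/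
def IsStringAlgebra (P : QuiverPresentation k A V E) : Prop :=
  P.Monomial ∧
  (∀ v : V, Nat.card {α : E // P.src α = v} ≤ 2) ∧
  (∀ v : V, Nat.card {α : E // P.tgt α = v} ≤ 2) ∧
  (∀ γ : E, Nat.card {β : E // P.src β = P.tgt γ ∧ P.arrow β * P.arrow γ ≠ 0} ≤ 1) ∧
  (∀ β : E, Nat.card {γ : E // P.src β = P.tgt γ ∧ P.arrow β * P.arrow γ ≠ 0} ≤ 1)

/-- Connectivity in the underlying graph, avoiding a given set of arrows. -/
def ConnAvoid (P : QuiverPresentation k A V E) (avoid : Set E) (a b : V) : Prop :=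
  ∃ l : List (E × Bool), P.IsWalkFrom a l b ∧ ∀ s ∈ l, s.1 ∉ avoid

def Connected (P : QuiverPresentation k A V E) : Prop := ∀ a b : V, P.ConnAvoid ∅ a b

/-- The underlying graph of the quiver is a tree. -/
def IsTreeQuiver (P : QuiverPresentation k A V E) : Prop :=
  P.Connected ∧ Fintype.card E + 1 = Fintype.card V

/-- The underlying (undirected) graph of the quiver is given by the edge-endpoint
specification `ends` on `nV` vertices and `nE` edges. -/
def GraphSpec (P : QuiverPresentation k A V E) (nV nE : ℕ) (ends : Fin nE → ℕ × ℕ) : Prop :=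
  ∃ (v : Fin nV ≃ V) (ar : Fin nE ≃ E), ∀ i : Fin nE, ∃ a b : Fin nV,
    (a : ℕ) = (ends i).1 ∧ (b : ℕ) = (ends i).2 ∧
    ((P.src (ar i) = v a ∧ P.tgt (ar i) = v b) ∨ (P.src (ar i) = v b ∧ P.tgt (ar i) = v a))

/-- The directed quiver is given by the arrow specification `ends`. -/
def DirGraphSpec (P : QuiverPresentation k A V E) (nV nE : ℕ) (ends : Fin nE → ℕ × ℕ) : Prop :=
  ∃ (v : Fin nV ≃ V) (ar : Fin nE ≃ E), ∀ i : Fin nE, ∃ a b : Fin nV,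
    (a : ℕ) = (ends i).1 ∧ (b : ℕ) = (ends i).2 ∧
    P.src (ar i) = v a ∧ P.tgt (ar i) = v b

/-- The underlying graph of the full subquiver on vertices `S` and arrows `T`. -/
def SubGraphSpec (P : QuiverPresentation k A V E) (S : Set V) (T : Set E)
    (nV nE : ℕ) (ends : Fin nE → ℕ × ℕ) : Prop :=
  ∃ (v : Fin nV ≃ S) (ar : Fin nE ≃ T), ∀ i : Fin nE, ∃ a b : Fin nV,
    (a : ℕ) = (ends i).1 ∧ (b : ℕ) = (ends i).2 ∧
    ((P.src (ar i) = v a ∧ P.tgt (ar i) = v b) ∨ (P.src (ar i) = v b ∧ P.tgt (ar i) = v a))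

end QuiverPresentation

/-- Edge endpoints of the Dynkin graph `A_n`. -/
def typeAEnds (n : ℕ) : Fin (n - 1) → ℕ × ℕ := fun i => ((i : ℕ), (i : ℕ) + 1)

/-- Edge endpoints of the Dynkin graph `D_n`. -/
def typeDEnds (n : ℕ) : Fin (n - 1) → ℕ × ℕ := fun i =>
  if (i : ℕ) = 0 then (0, 2) else if (i : ℕ) = 1 then (1, 2) else ((i : ℕ), (i : ℕ) + 1)

/-- Edge endpoints of the Dynkin graph `E_m` for `m = 6, 7, 8`. -/
def typeEEnds (m : ℕ) : Fin (m - 1) → ℕ × ℕ := fun i =>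
  if (i : ℕ) = m - 2 then (2, m - 1) else ((i : ℕ), (i : ℕ) + 1)

/-! ## The module category, its radical and the nilpotency index -/

section ModuleSide

variable (A : Type) [Ring A]

/-- An indecomposable module: non-zero, with no non-trivial idempotent endomorphism. -/
def Indec (M : ModuleCat.{0} A) : Prop :=
  Nontrivial M ∧ ∀ f : M ⟶ M, f ≫ f = f → f = 0 ∨ f = 𝟙 M

/-- A finitely generated indecomposable module. -/
def FinIndec (M : ModuleCat.{0} A) : Prop := Module.Finite A M ∧ Indec A M

/-- `A` is representation-finite: finitely many finitely generated indecomposables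
up to isomorphism. -/
def RepFinite : Prop :=
  ∃ (n : ℕ) (T : Fin n → ModuleCat.{0} A),
    ∀ M : ModuleCat.{0} A, FinIndec A M → ∃ i, Nonempty (M ≅ T i)

/-- `A` is (left) hereditary. -/
def Hereditary : Prop := ∀ I : Submodule A A, Module.Projective A I

/-- An irreducible morphism: it does not split, and in any factorization one of
the factors splits. -/
def IrredMor {X Y : ModuleCat.{0} A} (f : X ⟶ Y) : Prop :=
  (¬ ∃ g : Y ⟶ X, f ≫ g = 𝟙 X) ∧ (¬ ∃ g : Y ⟶ X, g ≫ f = 𝟙 Y) ∧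
  ∀ (Z : ModuleCat.{0} A), Module.Finite A Z → ∀ (u : X ⟶ Z) (v : Z ⟶ Y), f = u ≫ v →
    (∃ r : Z ⟶ X, u ≫ r = 𝟙 X) ∨ (∃ s : Y ⟶ Z, s ≫ v = 𝟙 Y)

/-- The radical of `Hom(X, Y)`. -/
def radSet (X Y : ModuleCat.{0} A) : Set (X ⟶ Y) :=
  {f | ∀ M : ModuleCat.{0} A, FinIndec A M →
    ∀ (h : M ⟶ X) (h' : Y ⟶ M), ¬ IsIso (h ≫ f ≫ h')}

/-- Compositions of `n` radical morphisms. -/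
def radPowSet : ℕ → ∀ (X Y : ModuleCat.{0} A), Set (X ⟶ Y)
  | 0, _, _ => Set.univ
  | n + 1, X, Y => {f | ∃ (M : ModuleCat.{0} A) (g : X ⟶ M) (h : M ⟶ Y),
      Module.Finite A M ∧ g ∈ radSet A X M ∧ h ∈ radPowSet n M Y ∧ f = g ≫ h}

/-- The `n`-th power of the radical of `mod A` vanishes. -/
def RadVanishes (n : ℕ) : Prop :=
  ∀ X Y : ModuleCat.{0} A, Module.Finite A X → Module.Finite A Y →
    ∀ f ∈ radPowSet A n X Y, f = 0

/-- `m` is the nilpotency index of the radical of `mod A`. -/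
def NilpotencyIndex (m : ℕ) : Prop :=
  1 ≤ m ∧ RadVanishes A m ∧ ∀ l : ℕ, RadVanishes A l → m ≤ l

/-- A path of irreducible morphisms between (f.g.) indecomposable modules,
together with its composite morphism and its length. -/
inductive IrrPath : ∀ (M N : ModuleCat.{0} A), (M ⟶ N) → ℕ → Prop
  | nil (M : ModuleCat.{0} A) : FinIndec A M → IrrPath M M (𝟙 M) 0
  | cons {M X N : ModuleCat.{0} A} (f : M ⟶ X) (g : X ⟶ N) (n : ℕ) :
      FinIndec A M → IrredMor A f → IrrPath X N g n → IrrPath M N (f ≫ g) (n + 1)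

/-- The Auslander–Reiten quiver of `A` is a component with length : parallel paths
of irreducible morphisms have the same length. -/
def WithLength : Prop :=
  ∀ (M N : ModuleCat.{0} A) (n m : ℕ),
    (∃ f : M ⟶ N, IrrPath A M N f n) → (∃ g : M ⟶ N, IrrPath A M N g m) → n = m

/-- `N` is a successor of `M` (a path of non-zero morphisms between f.g.
indecomposables from `M` to `N`). -/
inductive Reach : ModuleCat.{0} A → ModuleCat.{0} A → Prop
  | refl (M : ModuleCat.{0} A) : FinIndec A M → Reach M M
  | cons {M X N : ModuleCat.{0} A} : FinIndec A M → FinIndec A X →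
      (∃ f : M ⟶ X, f ≠ 0) → Reach X N → Reach M N

/-- `N` is a direct summand of `M`. -/
def IsSummand (N M : ModuleCat.{0} A) : Prop :=
  ∃ (i : N ⟶ M) (p : M ⟶ N), i ≫ p = 𝟙 N

/-- The radical of a module (intersection of the maximal submodules). -/
def radOf (M : ModuleCat.{0} A) : Submodule A M := sInf {N | IsCoatom N}

/-- The socle of a module (sum of the simple submodules). -/
def socOf (M : ModuleCat.{0} A) : Submodule A M := sSup {N | IsAtom N}

/-- `0 → X → E → Y → 0` is an almost split (Auslander–Reiten) sequence. -/
def IsAlmostSplit {X E Y : ModuleCat.{0} A} (f : X ⟶ E) (g : E ⟶ Y) : Prop :=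
  FinIndec A X ∧ FinIndec A Y ∧ Module.Finite A E ∧
  Function.Injective f ∧ Function.Surjective g ∧
  (∀ x : X, g (f x) = 0) ∧ (∀ e : E, g e = 0 → ∃ x : X, f x = e) ∧
  (¬ ∃ s : Y ⟶ E, s ≫ g = 𝟙 Y) ∧
  (∀ (M : ModuleCat.{0} A) (h : X ⟶ M), (¬ ∃ r : M ⟶ X, h ≫ r = 𝟙 X) →
    ∃ t : E ⟶ M, f ≫ t = h) ∧
  (∀ (M : ModuleCat.{0} A) (h : M ⟶ Y), (¬ ∃ s : Y ⟶ M, s ≫ h = 𝟙 Y) →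
    ∃ t : M ⟶ E, t ≫ g = h)

/-- `X = τ Y` : there is an almost split sequence `0 → X → E → Y → 0`. -/
def IsTauOf (X Y : ModuleCat.{0} A) : Prop :=
  ∃ (E : ModuleCat.{0} A) (f : X ⟶ E) (g : E ⟶ Y), IsAlmostSplit A f g

/-- A sectional path of irreducible morphisms of length `n` from `M` to `N`. -/
def SectionalPath (M N : ModuleCat.{0} A) (n : ℕ) : Prop :=
  ∃ Y : Fin (n + 1) → ModuleCat.{0} A,
    Y 0 = M ∧ Y (Fin.last n) = N ∧ (∀ i, FinIndec A (Y i)) ∧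
    (∀ i : Fin n, ∃ f : Y i.castSucc ⟶ Y i.succ, IrredMor A f) ∧
    ∀ (i : ℕ) (h : i + 2 ≤ n),
      ¬ IsTauOf A (Y ⟨i, by omega⟩) (Y ⟨i + 2, by omega⟩)

end ModuleSide

/-! ## Modules attached to vertices -/

section Vertices

variable {k A V E : Type} [Field k] [Ring A] [Algebra k A] [Fintype V] [Fintype E]

/-- `S` is the simple module at the vertex `a`. -/
def IsSimpleAt (P : QuiverPresentation k A V E) (a : V) (S : ModuleCat.{0} A) : Prop :=
  IsSimpleModule A S ∧ ∃ x : S, P.idem a • x ≠ 0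

/-- `Pm` is the indecomposable projective at the vertex `a`. -/
def IsProjAt (P : QuiverPresentation k A V E) (a : V) (Pm : ModuleCat.{0} A) : Prop :=
  Module.Projective A Pm ∧ FinIndec A Pm ∧
  ∃ (S : ModuleCat.{0} A) (f : Pm ⟶ S), IsSimpleAt P a S ∧ Function.Surjective f

/-- `Im` is the indecomposable injective at the vertex `a`. -/
def IsInjAt (P : QuiverPresentation k A V E) (a : V) (Im : ModuleCat.{0} A) : Prop :=
  Module.Injective A Im ∧ FinIndec A Im ∧
  ∃ (S : ModuleCat.{0} A) (f : S ⟶ Im), IsSimpleAt P a S ∧ Function.Injective f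

/-- `RVal P a n` : `n` is the length of a non-zero path of irreducible morphisms
between indecomposable modules from `P_a` to `I_a` going through `S_a`. -/
def RVal (P : QuiverPresentation k A V E) (a : V) (n : ℕ) : Prop :=
  ∃ (Pm S Im : ModuleCat.{0} A) (f : Pm ⟶ S) (g : S ⟶ Im) (n₁ n₂ : ℕ),
    IsProjAt P a Pm ∧ IsSimpleAt P a S ∧ IsInjAt P a Im ∧
    IrrPath A Pm S f n₁ ∧ IrrPath A S Im g n₂ ∧ f ≫ g ≠ 0 ∧ n = n₁ + n₂

end Vertices

namespace Preproj

/-- Adjacency in the Dynkin graph `D_n` on the vertices `0, …, n - 1`. -/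
def DAdj (n a b : ℕ) : Prop :=
  a < n ∧ b < n ∧ ((a = 0 ∧ b = 2) ∨ (a = 2 ∧ b = 0) ∨ (a = 1 ∧ b = 2) ∨ (a = 2 ∧ b = 1) ∨
    (2 ≤ a ∧ b = a + 1) ∨ (2 ≤ b ∧ a = b + 1))

/-- The preprojective relations of type `D_n` for elements `a l i` (the arrow `i → l`). -/
structure Rel (n : ℕ) {R : Type*} [Ring R] (a : ℕ → ℕ → R) : Prop where
  supp : ∀ l i, ¬ DAdj n l i → a l i = 0
  end0 : a 0 2 * a 2 0 = 0
  end1 : a 1 2 * a 2 1 = 0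
  mid : a 2 0 * a 0 2 + a 2 1 * a 1 2 + a 2 3 * a 3 2 = 0
  arm : ∀ j, 2 ≤ j → a (j + 1) j * a j (j + 1) + a (j + 1) (j + 2) * a (j + 2) (j + 1) = 0

/-- `Path n a m i j r`: `r` is the product of the `a`'s along a walk of length `m`
from `i` to `j`. -/
inductive Path (n : ℕ) {R : Type*} [Ring R] (a : ℕ → ℕ → R) : ℕ → ℕ → ℕ → R → Prop
  | nil (i : ℕ) : Path n a 0 i i 1
  | cons {m i j l : ℕ} {r : R} : DAdj n l j → Path n a m i j r → Path n a (m + 1) i l (a l j * r)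

variable {R : Type*} [Ring R]

/-- The product of the arrows along the walk `r, r + 1, …, r + t`. -/
def up (a : ℕ → ℕ → R) (r : ℕ) : ℕ → R
  | 0 => 1
  | t + 1 => a (r + t + 1) (r + t) * up a r t

/-- The product of the arrows along the walk `r + t, …, r + 1, r`. -/
def dn (a : ℕ → ℕ → R) (r : ℕ) : ℕ → R
  | 0 => 1
  | t + 1 => dn a r t * a (r + t) (r + t + 1)

variable {n : ℕ} {a : ℕ → ℕ → R}

lemma up_left (r t : ℕ) : up a r (t + 1) = up a (r + 1) t * a (r + 1) r := by
  induction t with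
  | zero => simp [up]
  | succ t ih =>
    rw [up, ih, up, mul_assoc]
    congr 2 <;> ring

lemma dn_left (r t : ℕ) : dn a r (t + 1) = a r (r + 1) * dn a (r + 1) t := by
  induction t with
  | zero => simp [dn]
  | succ t ih =>
    rw [dn, ih, dn, mul_assoc]
    congr 3 <;> ring

lemma Rel.op (h : Rel n a) : Rel n (fun l i => MulOpposite.op (a i l)) where
  supp l i hl := by
    rw [h.supp i l (fun hh => hl (by unfold DAdj at *; omega)), MulOpposite.op_zero]
  end0 := by rw [← MulOpposite.op_mul, h.end0, MulOpposite.op_zero]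
  end1 := by rw [← MulOpposite.op_mul, h.end1, MulOpposite.op_zero]
  mid := by simp only [← MulOpposite.op_mul, ← MulOpposite.op_add, h.mid, MulOpposite.op_zero]
  arm j hj := by
    simp only [← MulOpposite.op_mul, ← MulOpposite.op_add, h.arm j hj, MulOpposite.op_zero]

lemma up_op (r t : ℕ) :
    up (fun l i => MulOpposite.op (a i l)) r t = MulOpposite.op (dn a r t) := by
  induction t with
  | zero => rfl
  | succ t ih => rw [up, dn, ih, MulOpposite.op_mul]

lemma Rel.down_up (h : Rel n a) {r : ℕ} (hr : 2 ≤ r) (t : ℕ) :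
    a (r + t) (r + t + 1) * up a r (t + 1) =
      (-1) ^ t * (up a r t * (a r (r + 1) * a (r + 1) r)) := by
  induction t with
  | zero => simp [up]
  | succ t ih =>
    have h1 := eq_neg_of_add_eq_zero_right (h.arm (r + t) (by omega))
    rw [up, ← mul_assoc]
    have e : a (r + (t + 1)) (r + (t + 1) + 1) * a (r + (t + 1) + 1) (r + (t + 1)) =
      - (a (r + t + 1) (r + t) * a (r + t) (r + t + 1)) := h1
    rw [e, neg_mul, mul_assoc, ih, pow_succ, up]
    rcases neg_one_pow_eq_or R t with h2 | h2 <;> rw [h2] <;> noncomm_ring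

lemma Rel.up_eq_zero (h : Rel n a) (hn : 4 ≤ n) {t : ℕ} (ht : n ≤ 2 + t) : up a 2 t = 0 := by
  obtain ⟨t, rfl⟩ : ∃ s, t = s + 1 := ⟨t - 1, by omega⟩
  rw [up, h.supp _ _ (by unfold DAdj; omega), zero_mul]

lemma Rel.up_mul_pow (h : Rel n a) (hn : 4 ≤ n) (s : ℕ) :
    ∀ t, n ≤ 2 + t + s → up a 2 t * (a 2 0 * a 0 2 + a 2 1 * a 1 2) ^ s = 0 := by
  have hz := eq_neg_of_add_eq_zero_left h.mid
  induction s with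
  | zero => intro t ht; rw [h.up_eq_zero hn (by omega), zero_mul]
  | succ s ih =>
    intro t ht
    have h1 := h.down_up le_rfl t
    have h2 : up a 2 t * (a 2 3 * a 3 2) = (-1) ^ t * (a (2 + t) (2 + t + 1) * up a 2 (t + 1)) := by
      have e2 : (-1 : R) ^ t * (-1) ^ t = 1 := by
        rcases neg_one_pow_eq_or R t with h2 | h2 <;> simp [h2]
      rw [h1, ← mul_assoc ((-1 : R) ^ t), e2, one_mul]
    rw [pow_succ', ← mul_assoc]
    nth_rw 1 [hz]
    rw [mul_neg, h2, neg_mul, mul_assoc, mul_assoc, ih (t + 1) (by omega)]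
    simp

lemma Rel.pow_mul_dn (h : Rel n a) (hn : 4 ≤ n) (s t : ℕ) (hs : n ≤ 2 + t + s) :
    (a 2 0 * a 0 2 + a 2 1 * a 1 2) ^ s * dn a 2 t = 0 := by
  have := h.op.up_mul_pow hn s t hs
  rw [up_op] at this
  simp only [← MulOpposite.op_mul, ← MulOpposite.op_add, ← MulOpposite.op_pow] at this
  exact MulOpposite.op_eq_zero_iff _ |>.1 this

section Words

variable {x y : R}

lemma even_pow_comm (hx : x * x = 0) (hy : y * y = 0) (e : ℕ) :
    x * (x + y) ^ (2 * e) = (x + y) ^ (2 * e) * x := by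
  have h : Commute x ((x + y) ^ 2) := by
    show x * (x + y) ^ 2 = (x + y) ^ 2 * x
    have : (x + y) ^ 2 = x * y + y * x := by
      rw [pow_two, mul_add, add_mul, add_mul, hx, hy]; abel
    rw [this, mul_add, add_mul, ← mul_assoc, hx, mul_assoc, mul_assoc y, hx]
    simp
  rw [pow_mul]
  exact h.pow_right e

lemma odd_pow_comm (hx : x * x = 0) (hy : y * y = 0) (e : ℕ) :
    x * (x + y) ^ (2 * e + 1) = (x + y) ^ (2 * e + 1) * y := by
  rw [pow_succ', ← mul_assoc, mul_add, hx, zero_add, mul_assoc]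
  have := even_pow_comm hy hx e
  rw [add_comm y x] at this
  rw [this, ← mul_assoc, even_pow_comm hx hy, ← pow_succ', pow_succ, mul_assoc, mul_assoc,
    add_mul, hy, add_zero]

lemma word_step_left (hx : x * x = 0) (hy : y * y = 0) (u z d : R) :
    u * (-x + -y) * (x * z) * d = -(u * (y * ((x + y) * z)) * d) := by
  have : (-x + -y) * (x * z) = -(y * ((x + y) * z)) := by
    rw [add_mul, add_mul, mul_add, neg_mul, neg_mul, ← mul_assoc x x, hx, ← mul_assoc y y, hy]
    simp
  rw [mul_assoc u, this, mul_neg, neg_mul]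

lemma word_step_right (hx : x * x = 0) (hy : y * y = 0) (u z d : R) :
    u * (-x + -y) * (y * z) * d = -(u * (x * ((x + y) * z)) * d) := by
  rw [add_comm (-x), add_comm x, word_step_left hy hx]

lemma mul_pow_cases (hx : x * x = 0) (hy : y * y = 0) (e : ℕ) :
    x * (x + y) ^ e = (x + y) ^ e * x ∨ x * (x + y) ^ e = (x + y) ^ e * y := by
  rcases Nat.even_or_odd' e with ⟨e, rfl | rfl⟩
  · exact .inl (even_pow_comm hx hy e)
  · exact .inr (odd_pow_comm hx hy e)

lemma mul_word_eq_zero (hx : x * x = 0) (hy : y * y = 0) {u : R} {e : ℕ}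
    (hu : u * (x + y) ^ e = 0) : u * (x * (x + y) ^ e) = 0 := by
  rcases mul_pow_cases hx hy e with h | h <;> rw [h, ← mul_assoc, hu, zero_mul]

lemma mul_word_mul_eq_zero (hx : x * x = 0) (hy : y * y = 0) {u c : R} {e : ℕ}
    (hu : u * (x + y) ^ (e + 1) = 0) (hc : x * c = 0 ∨ y * c = 0) :
    u * (x * (x + y) ^ e) * c = 0 := by
  have h0 : u * ((x + y) ^ e * (x * c + y * c)) = 0 := by
    rw [← add_mul, ← mul_assoc, ← mul_assoc, mul_assoc u, ← pow_succ, hu, zero_mul]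
  rcases mul_pow_cases hx hy e with h | h <;> rw [h, mul_assoc, mul_assoc] <;>
    rcases hc with hc | hc
  · rw [hc, mul_zero, mul_zero]
  · rwa [hc, add_zero] at h0
  · rwa [hc, zero_add] at h0
  · rw [hc, mul_zero, mul_zero]

end Words

/-- Normal forms for the products along walks of length `m` from `i` to `j`. -/
inductive NF (a : ℕ → ℕ → R) (i m : ℕ) : ℕ → R → Prop
  | zero (j : ℕ) : NF a i m j 0
  | add {j : ℕ} {r r' : R} : NF a i m j r → NF a i m j r' → NF a i m j (r + r')
  | neg {j : ℕ} {r : R} : NF a i m j r → NF a i m j (-r)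
  | v {j : ℕ} (r t s : ℕ) : 2 ≤ r → i = r + s → j = r + t → m = t + s →
      NF a i m j (up a r t * dn a r s)
  | wx {j : ℕ} (t s e : ℕ) : i = 2 + s → j = 2 + t → m = t + s + 2 * (e + 1) →
      NF a i m j (up a 2 t * (a 2 0 * a 0 2 * (a 2 0 * a 0 2 + a 2 1 * a 1 2) ^ e) * dn a 2 s)
  | wy {j : ℕ} (t s e : ℕ) : i = 2 + s → j = 2 + t → m = t + s + 2 * (e + 1) →
      NF a i m j (up a 2 t * (a 2 1 * a 1 2 * (a 2 0 * a 0 2 + a 2 1 * a 1 2) ^ e) * dn a 2 s)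
  | b0 (s : ℕ) : i = 2 + s → m = s + 1 → NF a i m 0 (a 0 2 * dn a 2 s)
  | b0y (s e : ℕ) : i = 2 + s → m = s + 1 + 2 * (e + 1) →
      NF a i m 0 (a 0 2 * (a 2 1 * a 1 2 * (a 2 0 * a 0 2 + a 2 1 * a 1 2) ^ e) * dn a 2 s)
  | b1 (s : ℕ) : i = 2 + s → m = s + 1 → NF a i m 1 (a 1 2 * dn a 2 s)
  | b1x (s e : ℕ) : i = 2 + s → m = s + 1 + 2 * (e + 1) →
      NF a i m 1 (a 1 2 * (a 2 0 * a 0 2 * (a 2 0 * a 0 2 + a 2 1 * a 1 2) ^ e) * dn a 2 s)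

lemma NF.of_neg_one_pow {i m j : ℕ} {r : R} (h : NF a i m j r) (t : ℕ) :
    NF a i m j ((-1) ^ t * r) := by
  rcases neg_one_pow_eq_or R t with h2 | h2 <;> rw [h2]
  · simpa using h
  · simpa using h.neg

lemma Rel.xx (h : Rel n a) : a 2 0 * a 0 2 * (a 2 0 * a 0 2) = 0 := by
  rw [mul_assoc, ← mul_assoc (a 0 2), h.end0]; simp

lemma Rel.yy (h : Rel n a) : a 2 1 * a 1 2 * (a 2 1 * a 1 2) = 0 := by
  rw [mul_assoc, ← mul_assoc (a 1 2), h.end1]; simp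

lemma NF.step (h : Rel n a) {i m j l : ℕ} {r : R} (hr : NF a i m j r) (hl : DAdj n l j) :
    NF a i (m + 1) l (a l j * r) := by
  have hz : a 2 3 * a 3 2 = -(a 2 0 * a 0 2) + -(a 2 1 * a 1 2) := by
    rw [← neg_add]; exact eq_neg_of_add_eq_zero_right h.mid
  have hxx := h.xx
  have hyy := h.yy
  induction hr with
  | zero j => rw [mul_zero]; exact .zero _
  | add _ _ ih1 ih2 => rw [mul_add]; exact .add (ih1 hl) (ih2 hl)
  | neg _ ih => rw [mul_neg]; exact .neg (ih hl)
  | @v j r t s h1 h2 h3 h4 =>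
    subst h3
    obtain ⟨h5, h6, hl⟩ := hl
    have case_up : l = r + t + 1 → NF a i (m + 1) l (a l (r + t) * (up a r t * dn a r s)) := by
      rintro rfl
      rw [← mul_assoc]
      exact .v r (t + 1) s h1 h2 rfl (by omega)
    have case_down : l + 1 = r + t → 2 ≤ l →
        NF a i (m + 1) l (a l (r + t) * (up a r t * dn a r s)) := by
      intro hlr h2l
      rcases t with _ | t
      · obtain rfl : r = l + 1 := by omega
        have : a l (l + 1 + 0) * (up a (l + 1) 0 * dn a (l + 1) s) = up a l 0 * dn a l (s + 1) := by
          rw [dn_left]; simp [up]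
        rw [this]
        exact .v l 0 (s + 1) h2l (by omega) rfl (by omega)
      · obtain rfl : l = r + t := by omega
        have : a (r + t) (r + (t + 1)) * (up a r (t + 1) * dn a r s) =
            (-1) ^ t * (up a r t * (a r (r + 1) * a (r + 1) r) * dn a r s) := by
          rw [← mul_assoc, ← mul_assoc ((-1) ^ t), ← h.down_up h1]; rfl
        rw [this]
        refine NF.of_neg_one_pow ?_ t
        rcases Nat.lt_or_ge 2 r with hr | hr
        · obtain ⟨r, rfl⟩ : ∃ q, r = q + 1 := ⟨r - 1, by omega⟩
          have h7 := eq_neg_of_add_eq_zero_right (h.arm r (by omega))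
          have : up a (r + 1) t * (a (r + 1) (r + 1 + 1) * a (r + 1 + 1) (r + 1)) * dn a (r + 1) s =
            - (up a r (t + 1) * dn a r (s + 1)) := by
            rw [dn_left, up_left, h7]; noncomm_ring
          rw [this]
          exact .neg (.v r (t + 1) (s + 1) (by omega) (by omega) (by omega) (by omega))
        · obtain rfl : r = 2 := by omega
          rw [show a 2 (2 + 1) * a (2 + 1) 2 = a 2 3 * a 3 2 from rfl, hz, mul_add, mul_neg, mul_neg,
            add_mul, neg_mul, neg_mul]
          have hx := NF.wx (a := a) (i := i) (m := m + 1) (j := 2 + t) t s 0 h2 rfl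
            (by omega)
          have hy := NF.wy (a := a) (i := i) (m := m + 1) (j := 2 + t) t s 0 h2 rfl
            (by omega)
          rw [pow_zero, mul_one] at hx hy
          exact .add (.neg hx) (.neg hy)
    rcases hl with h | h | h | h | h | h
    · obtain ⟨rfl, h⟩ := h
      obtain ⟨rfl, rfl⟩ : r = 2 ∧ t = 0 := by omega
      simp only [up, one_mul]
      exact .b0 s h2 (by omega)
    · omega
    · obtain ⟨rfl, h⟩ := h
      obtain ⟨rfl, rfl⟩ : r = 2 ∧ t = 0 := by omega
      simp only [up, one_mul]
      exact .b1 s h2 (by omega)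
    · omega
    · exact case_down (by omega) (by omega)
    · exact case_up (by omega)
  | @wx j t s e h2 h3 h4 =>
    subst h3
    obtain ⟨h5, h6, hl⟩ := hl
    rcases hl with h' | h' | h' | h' | h' | h'
    · obtain ⟨rfl, h'⟩ := h'
      obtain rfl : t = 0 := by omega
      have : a 0 (2 + 0) * (up a 2 0 * (a 2 0 * a 0 2 * (a 2 0 * a 0 2 + a 2 1 * a 1 2) ^ e) *
          dn a 2 s) = 0 := by
        simp only [up, one_mul, ← mul_assoc, add_zero, h.end0, zero_mul]
      rw [this]; exact .zero _
    · omega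
    · obtain ⟨rfl, h'⟩ := h'
      obtain rfl : t = 0 := by omega
      simp only [up, one_mul, ← mul_assoc]
      have := NF.b1x (a := a) (i := i) (m := m + 1) s e h2 (by omega)
      simpa only [← mul_assoc] using this
    · omega
    · obtain ⟨t, rfl⟩ : ∃ q, t = q + 1 := ⟨t - 1, by omega⟩
      obtain rfl : l = 2 + t := by omega
      have : a (2 + t) (2 + (t + 1)) * (up a 2 (t + 1) *
          (a 2 0 * a 0 2 * (a 2 0 * a 0 2 + a 2 1 * a 1 2) ^ e) * dn a 2 s) =
          (-1) ^ t * -(up a 2 t * (a 2 1 * a 1 2 *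
            (a 2 0 * a 0 2 + a 2 1 * a 1 2) ^ (e + 1)) * dn a 2 s) := by
        rw [← mul_assoc, ← mul_assoc]
        rw [show a (2 + t) (2 + (t + 1)) * up a 2 (t + 1) = _ from h.down_up le_rfl t,
          show a 2 (2 + 1) * a (2 + 1) 2 = a 2 3 * a 3 2 from rfl, hz, pow_succ' _ e,
          ← word_step_left hxx hyy]
        simp only [mul_assoc]
      rw [this]
      exact (NF.neg (.wy t s (e + 1) h2 rfl (by omega))).of_neg_one_pow t
    · obtain rfl : l = 2 + t + 1 := by omega
      have := NF.wx (a := a) (i := i) (m := m + 1) (t + 1) s e h2 rfl (by omega)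
      rw [up] at this
      simp only [← mul_assoc] at this ⊢
      exact this
  | @wy j t s e h2 h3 h4 =>
    subst h3
    obtain ⟨h5, h6, hl⟩ := hl
    rcases hl with h' | h' | h' | h' | h' | h'
    · obtain ⟨rfl, h'⟩ := h'
      obtain rfl : t = 0 := by omega
      simp only [up, one_mul, ← mul_assoc]
      have := NF.b0y (a := a) (i := i) (m := m + 1) s e h2 (by omega)
      simpa only [← mul_assoc] using this
    · omega
    · obtain ⟨rfl, h'⟩ := h'
      obtain rfl : t = 0 := by omega
      have : a 1 (2 + 0) * (up a 2 0 * (a 2 1 * a 1 2 * (a 2 0 * a 0 2 + a 2 1 * a 1 2) ^ e) *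
          dn a 2 s) = 0 := by
        simp only [up, one_mul, ← mul_assoc, add_zero, h.end1, zero_mul]
      rw [this]; exact .zero _
    · omega
    · obtain ⟨t, rfl⟩ : ∃ q, t = q + 1 := ⟨t - 1, by omega⟩
      obtain rfl : l = 2 + t := by omega
      have : a (2 + t) (2 + (t + 1)) * (up a 2 (t + 1) *
          (a 2 1 * a 1 2 * (a 2 0 * a 0 2 + a 2 1 * a 1 2) ^ e) * dn a 2 s) =
          (-1) ^ t * -(up a 2 t * (a 2 0 * a 0 2 *
            (a 2 0 * a 0 2 + a 2 1 * a 1 2) ^ (e + 1)) * dn a 2 s) := by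
        rw [← mul_assoc, ← mul_assoc]
        rw [show a (2 + t) (2 + (t + 1)) * up a 2 (t + 1) = _ from h.down_up le_rfl t,
          show a 2 (2 + 1) * a (2 + 1) 2 = a 2 3 * a 3 2 from rfl, hz, pow_succ' _ e,
          ← word_step_right hxx hyy]
        simp only [mul_assoc]
      rw [this]
      exact (NF.neg (.wx t s (e + 1) h2 rfl (by omega))).of_neg_one_pow t
    · obtain rfl : l = 2 + t + 1 := by omega
      have := NF.wy (a := a) (i := i) (m := m + 1) (t + 1) s e h2 rfl (by omega)
      rw [up] at this
      simp only [← mul_assoc] at this ⊢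
      exact this
  | @b0 s h2 h4 =>
    obtain rfl : l = 2 := by unfold DAdj at hl; omega
    have := NF.wx (a := a) (i := i) (m := m + 1) 0 s 0 h2 rfl (by omega)
    simpa [up, mul_assoc] using this
  | @b0y s e h2 h4 =>
    obtain rfl : l = 2 := by unfold DAdj at hl; omega
    have := NF.wx (a := a) (i := i) (m := m + 1) 0 s (e + 1) h2 rfl (by omega)
    rw [pow_succ', ← mul_assoc (a 2 0 * a 0 2), mul_add (a 2 0 * a 0 2), hxx, zero_add] at this
    simpa [up, mul_assoc] using this
  | @b1 s h2 h4 =>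
    obtain rfl : l = 2 := by unfold DAdj at hl; omega
    have := NF.wy (a := a) (i := i) (m := m + 1) 0 s 0 h2 rfl (by omega)
    simpa [up, mul_assoc] using this
  | @b1x s e h2 h4 =>
    obtain rfl : l = 2 := by unfold DAdj at hl; omega
    have := NF.wy (a := a) (i := i) (m := m + 1) 0 s (e + 1) h2 rfl (by omega)
    rw [pow_succ', ← mul_assoc (a 2 1 * a 1 2), mul_add (a 2 1 * a 1 2), hyy, add_zero] at this
    simpa [up, mul_assoc] using this

lemma NF.eq_zero (h : Rel n a) (hn : 4 ≤ n) {i j : ℕ} {r : R} (hi : i < n) (hj : j < n)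
    (hr : NF a i (2 * n - 3) j r) : r = 0 := by
  induction hr with
  | zero j => rfl
  | add _ _ ih1 ih2 => rw [ih1 hj, ih2 hj, add_zero]
  | neg _ ih => rw [ih hj, neg_zero]
  | v r t s => omega
  | wx t s e h1 h2 h3 =>
    rcases lt_or_ge s t with hst | hst
    · rw [mul_word_eq_zero h.xx h.yy (h.up_mul_pow hn e t (by omega)), zero_mul]
    · rw [mul_assoc, mul_assoc (_ * _), h.pow_mul_dn hn e s (by omega), mul_zero, mul_zero]
  | wy t s e h1 h2 h3 =>
    rcases lt_or_ge s t with hst | hst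
    · have := h.up_mul_pow hn e t (by omega)
      rw [add_comm] at this ⊢
      rw [mul_word_eq_zero h.yy h.xx this, zero_mul]
    · rw [mul_assoc, mul_assoc (_ * _), h.pow_mul_dn hn e s (by omega), mul_zero, mul_zero]
  | b0 s => omega
  | b0y s e h1 h2 =>
    have h3 : a 0 2 * (a 2 1 * a 1 2) = a 0 2 * (a 2 0 * a 0 2 + a 2 1 * a 1 2) := by
      rw [mul_add, ← mul_assoc _ (a 2 0), h.end0, zero_mul, zero_add]
    rw [← mul_assoc (a 0 2), h3, mul_assoc, mul_assoc, ← mul_assoc (_ + _), ← pow_succ',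
      h.pow_mul_dn hn (e + 1) s (by omega), mul_zero]
  | b1 s => omega
  | b1x s e h1 h2 =>
    have h3 : a 1 2 * (a 2 0 * a 0 2) = a 1 2 * (a 2 0 * a 0 2 + a 2 1 * a 1 2) := by
      rw [mul_add, ← mul_assoc _ (a 2 1), h.end1, zero_mul, add_zero]
    rw [← mul_assoc (a 1 2), h3, mul_assoc, mul_assoc, ← mul_assoc (_ + _), ← pow_succ',
      h.pow_mul_dn hn (e + 1) s (by omega), mul_zero]

lemma NF.mul_eq_zero (h : Rel n a) (hn : 4 ≤ n) {j : ℕ} {r : R} (hj : j < n)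
    (hr : NF a 2 (2 * n - 4) j r) {c : R}
    (hc : a 2 0 * a 0 2 * c = 0 ∨ a 2 1 * a 1 2 * c = 0) : r * c = 0 := by
  induction hr with
  | zero j => rw [zero_mul]
  | add _ _ ih1 ih2 => rw [add_mul, ih1 hj, ih2 hj, add_zero]
  | neg _ ih => rw [neg_mul, ih hj, neg_zero]
  | v r t s => omega
  | wx t s e h1 h2 h3 =>
    obtain rfl : s = 0 := by omega
    rw [dn, mul_one]
    exact mul_word_mul_eq_zero h.xx h.yy (h.up_mul_pow hn (e + 1) t (by omega)) hc
  | wy t s e h1 h2 h3 =>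
    obtain rfl : s = 0 := by omega
    rw [dn, mul_one]
    have := h.up_mul_pow hn (e + 1) t (by omega)
    rw [add_comm (_ * _)] at this ⊢
    exact mul_word_mul_eq_zero h.yy h.xx this hc.symm
  | b0 s => omega
  | b0y s e => omega
  | b1 s => omega
  | b1x s e => omega

lemma Path.nf (h : Rel n a) {m i j : ℕ} {r : R} (hr : Path n a m i j r) (hi : 2 ≤ i) :
    NF a i m j r := by
  induction hr with
  | nil i => simpa [up, dn] using NF.v (a := a) (i := i) (m := 0) (j := i) i 0 0 hi rfl rfl rfl
  | cons hl _ ih => exact (ih hi).step h hl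

lemma Path.exists_eq_mul {m i j : ℕ} {r : R} (hr : Path n a m i j r) (hm : m ≠ 0) :
    ∃ l r', DAdj n l i ∧ Path n a (m - 1) l j r' ∧ r = r' * a l i := by
  induction hr with
  | nil i => exact absurd rfl hm
  | @cons m i j l r hl hr ih =>
    rcases m with _ | m
    · cases hr
      exact ⟨l, 1, hl, .nil l, by simp⟩
    · obtain ⟨l', r', h1, h2, rfl⟩ := ih (by omega)
      exact ⟨l', a l j * r', h1, .cons hl h2, (mul_assoc _ _ _).symm⟩

lemma Path.lt {m i j : ℕ} {r : R} (hr : Path n a m i j r) (hi : i < n) : j < n := by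
  cases hr with
  | nil => exact hi
  | cons hl => exact hl.1

/-- In type `D_n` every walk of length `2 * n - 3` vanishes in the preprojective algebra. -/
theorem Path.eq_zero (h : Rel n a) (hn : 4 ≤ n) {i j : ℕ} {r : R}
    (hr : Path n a (2 * n - 3) i j r) (hi : i < n) : r = 0 := by
  have hj := hr.lt hi
  rcases Nat.lt_or_ge i 2 with h2 | h2
  · obtain ⟨l, r', h3, h4, rfl⟩ := hr.exists_eq_mul (by omega)
    obtain rfl : l = 2 := by unfold DAdj at h3; omega
    refine NF.mul_eq_zero h hn hj (h4.nf h le_rfl) ?_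
    obtain rfl | rfl : i = 0 ∨ i = 1 := by omega
    · left; rw [mul_assoc, h.end0, mul_zero]
    · right; rw [mul_assoc, h.end1, mul_zero]
  · exact NF.eq_zero h hn hi hj (hr.nf h h2)

end Preproj

/-- A representation of a quiver without parallel arrows, with arrows `i ⟶ l` whenever
`adj i l` and `p i = p l + 1`, presented on an ambient space carrying all the components. -/
structure QRep (k : Type) [Field k] {I : Type} (adj : I → I → Prop) (p : I → ℕ) where
  M : Type
  [grp : AddCommGroup M]
  [mod : Module k M]
  c : I → Submodule k M
  φ : I → I → M →ₗ[k] M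
  e : I → M →ₗ[k] M
  e_self : ∀ {j x}, x ∈ c j → e j x = x
  e_ne : ∀ {i j x}, i ≠ j → x ∈ c i → e j x = 0
  φ_mem : ∀ {i x} l, x ∈ c i → φ i l x ∈ c l
  φ_zero : ∀ {i l x}, ¬ (adj i l ∧ p i = p l + 1) → x ∈ c i → φ i l x = 0

attribute [instance] QRep.grp QRep.mod

/-- A height function on a graph for which neighbours have adjacent heights. -/
structure IsHeight {I : Type} (adj : I → I → Prop) (p : I → ℕ) : Prop where
  symm : ∀ {i l}, adj i l → adj l i
  step : ∀ {i l}, adj i l → p i = p l + 1 ∨ p l = p i + 1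

namespace QRep

variable {k : Type} [Field k] {I : Type} {adj : I → I → Prop} {p : I → ℕ}

/-- The linear map along a word of vertices. -/
def word (X : QRep k adj p) : List I → I → X.M →ₗ[k] X.M
  | [], _ => LinearMap.id
  | l :: γ, i => X.word γ l ∘ₗ X.φ i l

/-- All the values of an element along the words of vertices. -/
def lift (X : QRep k adj p) (i : I) : X.M →ₗ[k] (List I → X.M) :=
  LinearMap.pi fun γ => X.word γ i

/-- The shift of a function of words by one letter. -/
def S (M : Type) [AddCommGroup M] [Module k M] (l : I) : (List I → M) →ₗ[k] (List I → M) :=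
  LinearMap.funLeft k M (List.cons l)

@[simp] lemma S_apply {M : Type} [AddCommGroup M] [Module k M] (l : I) (ξ : List I → M)
    (γ : List I) : S (k := k) M l ξ γ = ξ (l :: γ) := rfl

lemma S_lift (X : QRep k adj p) (i l : I) (x : X.M) :
    S (k := k) X.M l (X.lift i x) = X.lift l (X.φ i l x) := rfl

lemma lift_nil (X : QRep k adj p) (i : I) (x : X.M) : X.lift i x [] = x := rfl

lemma S_compLeft {M N : Type} [AddCommGroup M] [Module k M] [AddCommGroup N] [Module k N]
    (f : M →ₗ[k] N) (l : I) (ξ : List I → M) :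
    S (k := k) N l (f.compLeft (List I) ξ) = f.compLeft (List I) (S (k := k) M l ξ) := rfl

variable {X Y : QRep k adj p}

/-- Morphisms of representations. -/
structure IsHom (X Y : QRep k adj p) (f : X.M →ₗ[k] Y.M) : Prop where
  mem : ∀ {i x}, x ∈ X.c i → f x ∈ Y.c i
  comm : ∀ {i l x}, x ∈ X.c i → f (X.φ i l x) = Y.φ i l (f x)

lemma IsHom.word {f : X.M →ₗ[k] Y.M} (hf : IsHom X Y f) (γ : List I) :
    ∀ {i x}, x ∈ X.c i → f (X.word γ i x) = Y.word γ i (f x) := by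
  induction γ with
  | nil => intro i x _; rfl
  | cons l γ ih =>
    intro i x hx
    change f (X.word γ l (X.φ i l x)) = Y.word γ l (Y.φ i l (f x))
    rw [ih (X.φ_mem l hx), hf.comm hx]

lemma IsHom.compLeft_lift {f : X.M →ₗ[k] Y.M} (hf : IsHom X Y f) {i : I} {x : X.M}
    (hx : x ∈ X.c i) : f.compLeft (List I) (X.lift i x) = Y.lift i (f x) :=
  funext fun γ => hf.word γ hx

variable [Fintype I]

/-- The reflected space at the vertex `i`, the kernel of the mesh map. -/
def reflect {M : Type} [AddCommGroup M] [Module k M] (adj : I → I → Prop)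
    (K : I → Submodule k (List I → M)) (i : I) : Submodule k (List I → M) where
  carrier := {ξ | ξ [] = 0 ∧ (∀ l, adj i l → S (k := k) M l ξ ∈ K l) ∧
    (∀ l, ¬ adj i l → S (k := k) M l ξ = 0) ∧ ∑ l, S (k := k) M i (S (k := k) M l ξ) = 0}
  zero_mem' := by simp
  add_mem' := by
    rintro ξ η ⟨h1, h2, h3, h4⟩ ⟨g1, g2, g3, g4⟩
    refine ⟨by simp [h1, g1], fun l hl => ?_, fun l hl => ?_, ?_⟩
    · rw [map_add]; exact add_mem (h2 l hl) (g2 l hl)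
    · rw [map_add, h3 l hl, g3 l hl, add_zero]
    · simp only [map_add, Finset.sum_add_distrib, h4, g4, add_zero]
  smul_mem' := by
    rintro c ξ ⟨h1, h2, h3, h4⟩
    refine ⟨by simp [h1], fun l hl => ?_, fun l hl => ?_, ?_⟩
    · rw [map_smul]; exact Submodule.smul_mem _ _ (h2 l hl)
    · rw [map_smul, h3 l hl, smul_zero]
    · simp only [map_smul, ← Finset.smul_sum, h4, smul_zero]

lemma mem_reflect {M : Type} [AddCommGroup M] [Module k M]
    {K : I → Submodule k (List I → M)} {i : I} {ξ : List I → M} :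
    ξ ∈ reflect adj K i ↔ ξ [] = 0 ∧ (∀ l, adj i l → S (k := k) M l ξ ∈ K l) ∧
    (∀ l, ¬ adj i l → S (k := k) M l ξ = 0) ∧ ∑ l, S (k := k) M i (S (k := k) M l ξ) = 0 := Iff.rfl

/-- The spaces of morphisms from the objects of the translation quiver to `X`. -/
def H (X : QRep k adj p) : ℕ → ∀ _ : I, Submodule k (List I → X.M)
  | 0, i => if p i = 0 then (X.c i).map (X.lift i) else ⊥
  | t + 1, i => if p i = t + 1 then (X.c i).map (X.lift i) else
      if p i < t + 1 ∧ (t + 1) % 2 = p i % 2 then reflect adj (X.H t) i else ⊥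

lemma H_self (X : QRep k adj p) {t : ℕ} {i : I} (h : p i = t) :
    X.H t i = (X.c i).map (X.lift i) := by
  cases t <;> simp [H, h]

lemma H_reflect (X : QRep k adj p) {t : ℕ} {i : I} (h : p i < t + 1) (h' : (t + 1) % 2 = p i % 2) :
    X.H (t + 1) i = reflect adj (X.H t) i := by
  rw [H, if_neg h.ne, if_pos ⟨h, h'⟩]

lemma H_bot (X : QRep k adj p) {t : ℕ} {i : I} (h : t < p i ∨ t % 2 ≠ p i % 2) :
    X.H t i = ⊥ := by
  cases t
  · rw [H, if_neg (by rintro h1; simp [h1] at h)]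
  · rw [H, if_neg (by rintro h1; simp [h1] at h), if_neg (by omega)]

lemma H_cases (X : QRep k adj p) (t : ℕ) (i : I) :
    p i = t ∨ (∃ s, t = s + 1 ∧ p i < s + 1 ∧ (s + 1) % 2 = p i % 2) ∨ X.H t i = ⊥ := by
  by_cases h : t < p i ∨ t % 2 ≠ p i % 2
  · exact .inr (.inr (X.H_bot h))
  · push Not at h
    rcases h.1.eq_or_lt with h1 | h1
    · exact .inl h1
    · exact .inr (.inl ⟨t - 1, by omega, by omega, by rw [← h.2]; congr 1; omega⟩)

lemma S_mem {t : ℕ} {i l : I} (hil : adj i l) {ξ : List I → X.M}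
    (hξ : ξ ∈ X.H (t + 1) i) : S (k := k) X.M l ξ ∈ X.H t l := by
  rcases X.H_cases (t + 1) i with h | ⟨s, h1, h2, h3⟩ | h
  · rw [X.H_self h] at hξ
    obtain ⟨x, hx, rfl⟩ := hξ
    rw [S_lift]
    by_cases h2 : p i = p l + 1
    · rw [X.H_self (by omega)]
      exact ⟨_, X.φ_mem l hx, rfl⟩
    · rw [X.φ_zero (by tauto) hx, map_zero]
      exact zero_mem _
  · obtain rfl : t = s := by omega
    rw [X.H_reflect h2 h3, mem_reflect] at hξ
    exact hξ.2.1 l hil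
  · rw [h, Submodule.mem_bot] at hξ
    rw [hξ, map_zero]; exact zero_mem _

lemma S_not_adj {t : ℕ} {i l : I} (hil : ¬ adj i l) {ξ : List I → X.M}
    (hξ : ξ ∈ X.H t i) : S (k := k) X.M l ξ = 0 := by
  rcases X.H_cases t i with h | ⟨s, rfl, h2, h3⟩ | h
  · rw [X.H_self h] at hξ
    obtain ⟨x, hx, rfl⟩ := hξ
    rw [S_lift, X.φ_zero (by tauto) hx, map_zero]
  · rw [X.H_reflect h2 h3, mem_reflect] at hξ
    exact hξ.2.2.1 l hil
  · rw [h, Submodule.mem_bot] at hξ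
    rw [hξ, map_zero]

lemma S_zero {i l : I} {ξ : List I → X.M} (hξ : ξ ∈ X.H 0 i) : S (k := k) X.M l ξ = 0 := by
  rcases X.H_cases 0 i with h | ⟨s, h1, h2, h3⟩ | h
  · rw [X.H_self h] at hξ
    obtain ⟨x, hx, rfl⟩ := hξ
    rw [S_lift, X.φ_zero (by omega) hx, map_zero]
  · omega
  · rw [h, Submodule.mem_bot] at hξ
    rw [hξ, map_zero]

lemma mesh {t : ℕ} {i : I} {ξ : List I → X.M} (hξ : ξ ∈ X.H t i) :
    ∑ l, S (k := k) X.M i (S (k := k) X.M l ξ) = 0 := by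
  rcases X.H_cases t i with h | ⟨s, rfl, h2, h3⟩ | h
  · rw [X.H_self h] at hξ
    obtain ⟨x, hx, rfl⟩ := hξ
    refine Finset.sum_eq_zero fun l _ => ?_
    rw [S_lift, S_lift]
    by_cases hl : p i = p l + 1
    · rw [X.φ_zero (by omega) (X.φ_mem l hx), map_zero]
    · rw [X.φ_zero (i := i) (l := l) (by tauto) hx, map_zero, map_zero]
  · rw [X.H_reflect h2 h3, mem_reflect] at hξ
    exact hξ.2.2.2
  · rw [h, Submodule.mem_bot] at hξ
    simp [hξ]

lemma IsHom.compLeft_mem {f : X.M →ₗ[k] Y.M} (hf : IsHom X Y f) (t : ℕ) :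
    ∀ {i : I} {ξ : List I → X.M}, ξ ∈ X.H t i → f.compLeft (List I) ξ ∈ Y.H t i := by
  induction t with
  | zero =>
    intro i ξ hξ
    rcases X.H_cases 0 i with h | ⟨s, h1, h2, h3⟩ | h
    · rw [X.H_self h] at hξ
      obtain ⟨x, hx, rfl⟩ := hξ
      rw [Y.H_self h, hf.compLeft_lift hx]
      exact ⟨_, hf.mem hx, rfl⟩
    · omega
    · rw [h, Submodule.mem_bot] at hξ
      rw [hξ, map_zero]; exact zero_mem _
  | succ t ih =>
    intro i ξ hξ
    rcases X.H_cases (t + 1) i with h | ⟨s, h1, h2, h3⟩ | h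
    · rw [X.H_self h] at hξ
      obtain ⟨x, hx, rfl⟩ := hξ
      rw [Y.H_self h, hf.compLeft_lift hx]
      exact ⟨_, hf.mem hx, rfl⟩
    · obtain rfl : t = s := by omega
      rw [X.H_reflect h2 h3, mem_reflect] at hξ
      rw [Y.H_reflect h2 h3, mem_reflect]
      obtain ⟨g1, g2, g3, g4⟩ := hξ
      refine ⟨by simp [g1], fun l hl => ?_, fun l hl => ?_, ?_⟩
      · rw [S_compLeft]; exact ih (g2 l hl)
      · rw [S_compLeft, g3 l hl, map_zero]
      · simp only [S_compLeft, ← map_sum, g4, map_zero]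
    · rw [h, Submodule.mem_bot] at hξ
      rw [hξ, map_zero]; exact zero_mem _

lemma apply_mem (γ : List I) :
    ∀ {t : ℕ} {i : I} {ξ : List I → X.M}, ξ ∈ X.H t i → ∃ j, ξ γ ∈ X.c j := by
  induction γ with
  | nil =>
    intro t i ξ hξ
    refine ⟨i, ?_⟩
    rcases X.H_cases t i with h | ⟨s, rfl, h2, h3⟩ | h
    · rw [X.H_self h] at hξ
      obtain ⟨x, hx, rfl⟩ := hξ
      exact hx
    · rw [X.H_reflect h2 h3, mem_reflect] at hξ
      rw [hξ.1]; exact zero_mem _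
    · rw [h, Submodule.mem_bot] at hξ
      rw [hξ]; exact zero_mem _
  | cons l γ ih =>
    intro t i ξ hξ
    rw [← S_apply (k := k) l ξ γ]
    by_cases hl : adj i l
    · rcases t with _ | t
      · rw [S_zero hξ]; exact ⟨i, zero_mem _⟩
      · exact ih (S_mem hl hξ)
    · rw [S_not_adj hl hξ]; exact ⟨i, zero_mem _⟩

lemma exists_factor {V W U : Type} [AddCommGroup V] [Module k V] [AddCommGroup W] [Module k W]
    [AddCommGroup U] [Module k U] (N : Submodule k V) (A : V →ₗ[k] W) (B : V →ₗ[k] U)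
    (h : ∀ v ∈ N, A v = 0 → B v = 0) :
    ∃ Ψ : W →ₗ[k] U, (∀ v ∈ N, Ψ (A v) = B v) ∧ ∀ w, ∃ v ∈ N, Ψ w = B v := by
  obtain ⟨s, hs⟩ := (A.domRestrict N).rangeRestrict.exists_rightInverse_of_surjective
    (LinearMap.range_rangeRestrict _)
  obtain ⟨σ, hσ⟩ := s.exists_extend
  refine ⟨B ∘ₗ N.subtype ∘ₗ σ, fun v hv => ?_, fun w => ⟨σ w, (σ w).2, rfl⟩⟩
  have h1 : A (σ (A v)) = A v := by
    have h2 : σ (A v) = s ((A.domRestrict N).rangeRestrict ⟨v, hv⟩) := by rw [← hσ]; rfl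
    have h3 := LinearMap.congr_fun hs ((A.domRestrict N).rangeRestrict ⟨v, hv⟩)
    rw [h2]
    exact congrArg Subtype.val h3
  have h2 := h (σ (A v) - v) (sub_mem (σ (A v)).2 hv) (by rw [map_sub, h1, sub_self])
  rw [map_sub, sub_eq_zero] at h2
  exact h2

/-- A compatible family of maps on a slice comes from a morphism of representations. -/
theorem full [DecidableEq I] (hp : IsHeight adj p) :
    ∀ (N : ℕ) (q : I → ℕ), ∑ i, (q i - p i) = N → IsHeight adj q → (∀ i, p i ≤ q i) →
    (∀ i, q i % 2 = p i % 2) →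
    ∀ G : I → (List I → Y.M) →ₗ[k] (List I → X.M),
    (∀ i, ∀ ξ ∈ Y.H (q i) i, G i ξ ∈ X.H (q i) i) →
    (∀ i l, adj i l → q i = q l + 1 → ∀ ξ ∈ Y.H (q i) i,
      S (k := k) X.M l (G i ξ) = G l (S (k := k) Y.M l ξ)) →
    ∃ g : Y.M →ₗ[k] X.M, IsHom Y X g ∧
      ∀ i, ∀ ξ ∈ Y.H (q i) i, G i ξ = g.compLeft (List I) ξ := by
  intro N
  induction N using Nat.strong_induction_on with
  | _ N ih =>
  intro q hN hq hpq hpar G hG hGS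
  by_cases hne : ∃ i, p i < q i
  · obtain ⟨i0, hi0, hmax⟩ : ∃ i0, p i0 < q i0 ∧ ∀ i, p i < q i → q i ≤ q i0 := by
      obtain ⟨i0, h1, h2⟩ := (Finset.univ.filter fun i => p i < q i).exists_max_image q
        (by obtain ⟨i, hi⟩ := hne; exact ⟨i, by simpa using hi⟩)
      exact ⟨i0, by simpa using h1, fun i hi => h2 i (by simpa using hi)⟩
    obtain ⟨t, ht⟩ : ∃ t, q i0 = t + 2 := ⟨q i0 - 2, by have := hpar i0; omega⟩
    have hpt : p i0 ≤ t ∧ t % 2 = p i0 % 2 := by have := hpar i0; omega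
    have hnb : ∀ l, adj i0 l → q l = t + 1 := by
      intro l hl
      rcases hq.step hl with h | h
      · omega
      · have := hmax l (by rcases hp.step hl with h | h <;> omega)
        omega
    set N0 : Submodule k (I → List I → Y.M) :=
      Submodule.pi Set.univ fun l => if adj i0 l then Y.H (t + 1) l else ⊥ with hN0
    have hN0m : ∀ η, η ∈ N0 ↔ (∀ l, adj i0 l → η l ∈ Y.H (t + 1) l) ∧
        ∀ l, ¬ adj i0 l → η l = 0 := by
      intro η
      rw [hN0, Submodule.mem_pi]
      constructor
      · intro h
        refine ⟨fun l hl => ?_, fun l hl => ?_⟩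
        · simpa [hl] using h l trivial
        · simpa [hl] using h l trivial
      · rintro ⟨h1, h2⟩ l -
        by_cases hl : adj i0 l
        · simpa [hl] using h1 l hl
        · simpa [hl] using h2 l hl
    set A1 : (I → List I → Y.M) →ₗ[k] (List I → Y.M) :=
      ∑ l, S (k := k) Y.M i0 ∘ₗ LinearMap.proj l with hA1
    set A2 : (I → List I → Y.M) →ₗ[k] (List I → X.M) :=
      ∑ l, S (k := k) X.M i0 ∘ₗ G l ∘ₗ LinearMap.proj l with hA2
    have hA1a : ∀ η, A1 η = ∑ l, S (k := k) Y.M i0 (η l) := by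
      intro η; simp [hA1, LinearMap.sum_apply]
    have hA2a : ∀ η, A2 η = ∑ l, S (k := k) X.M i0 (G l (η l)) := by
      intro η; simp [hA2, LinearMap.sum_apply]
    have hmX := X.H_reflect (t := t + 1) (i := i0) (by omega) (by omega)
    have hmY := Y.H_reflect (t := t + 1) (i := i0) (by omega) (by omega)
    obtain ⟨Ψ, hΨ1, hΨ2⟩ := exists_factor N0 A1 A2 (by
      intro η hη h0
      rw [hN0m] at hη
      rw [hA1a] at h0
      rw [hA2a]
      set ζ : List I → Y.M := fun γ => match γ with
        | [] => 0
        | l :: γ => η l γ with hζ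
      have hSζ : ∀ l, S (k := k) Y.M l ζ = η l := fun l => rfl
      have hζm : ζ ∈ Y.H (t + 1 + 1) i0 := by
        rw [hmY, mem_reflect]
        exact ⟨rfl, fun l hl => by rw [hSζ]; exact hη.1 l hl,
          fun l hl => by rw [hSζ]; exact hη.2 l hl, by simpa only [hSζ] using h0⟩
      have h1 := hG i0 ζ (by rw [ht]; exact hζm)
      rw [← mesh h1]
      refine Finset.sum_congr rfl fun l _ => ?_
      congr 1
      by_cases hl : adj i0 l
      · rw [hGS i0 l hl (by rw [ht, hnb l hl]) ζ (by rw [ht]; exact hζm), hSζ]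
      · rw [S_not_adj hl h1, hη.2 l hl, map_zero])
    have hq' : IsHeight adj (Function.update q i0 t) := by
      refine ⟨hp.symm, fun {i l} hil => ?_⟩
      have h1 : ¬ adj i0 i0 := fun h => by rcases hp.step h with h | h <;> omega
      by_cases hi : i = i0
      · subst hi
        have hl : l ≠ i := by rintro rfl; exact h1 hil
        rw [Function.update_self, Function.update_of_ne hl, hnb l hil]
        omega
      · by_cases hl : l = i0
        · subst hl
          rw [Function.update_self, Function.update_of_ne hi, hnb i (hp.symm hil)]
          omega
        · rw [Function.update_of_ne hi, Function.update_of_ne hl]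
          exact hq.step hil
    obtain ⟨g, hg, hgG⟩ := ih (∑ i, (Function.update q i0 t i - p i)) (by
        rw [← hN]
        refine Finset.sum_lt_sum (fun i _ => ?_) ⟨i0, Finset.mem_univ _, ?_⟩
        · by_cases hi : i = i0
          · subst hi; rw [Function.update_self]; omega
          · rw [Function.update_of_ne hi]
        · rw [Function.update_self]; omega) (Function.update q i0 t) rfl hq'
      (by
        intro i
        by_cases hi : i = i0
        · subst hi; rw [Function.update_self]; omega
        · rw [Function.update_of_ne hi]; exact hpq i)
      (by
        intro i
        by_cases hi : i = i0
        · subst hi; rw [Function.update_self]; omega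
        · rw [Function.update_of_ne hi]; exact hpar i)
      (Function.update G i0 Ψ)
      (by
        intro i ξ hξ
        by_cases hi : i = i0
        · subst hi
          rw [Function.update_self] at hξ ⊢
          rw [Function.update_self]
          obtain ⟨η, hη, h⟩ := hΨ2 ξ
          rw [hN0m] at hη
          rw [h, hA2a]
          refine sum_mem fun l _ => ?_
          by_cases hl : adj i l
          · refine S_mem (hp.symm hl) ?_
            have := hG l (η l) (by rw [hnb l hl]; exact hη.1 l hl)
            rwa [hnb l hl] at this
          · rw [hη.2 l hl, map_zero, map_zero]; exact zero_mem _
        · rw [Function.update_of_ne hi] at hξ ⊢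
          rw [Function.update_of_ne hi]
          exact hG i ξ hξ)
      (by
        intro i l hil h ξ hξ
        by_cases hi : i = i0
        · subst hi
          have hl : l ≠ i := by
            rintro rfl; rcases hp.step hil with h | h <;> omega
          rw [Function.update_self, Function.update_of_ne hl, hnb l hil] at h
          omega
        · rw [Function.update_of_ne hi] at hξ h ⊢
          by_cases hl : l = i0
          · subst hl
            rw [Function.update_self]
            have h1 := hp.symm hil
            have h2 : Pi.single i ξ ∈ N0 := by
              rw [hN0m]
              refine ⟨fun j hj => ?_, fun j hj => ?_⟩
              · by_cases hji : j = i
                · subst hji; rw [Pi.single_eq_same, ← hnb j h1]; exact hξ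
                · rw [Pi.single_eq_of_ne hji]; exact zero_mem _
              · rw [Pi.single_eq_of_ne]; rintro rfl; exact hj h1
            have h3 := hΨ1 _ h2
            rw [hA1a, hA2a, Finset.sum_eq_single i, Finset.sum_eq_single i, Pi.single_eq_same] at h3
            · exact h3.symm
            · intro j _ hj; rw [Pi.single_eq_of_ne hj, map_zero, map_zero]
            · simp
            · intro j _ hj; rw [Pi.single_eq_of_ne hj, map_zero]
            · simp
          · rw [Function.update_of_ne hl] at h ⊢
            exact hGS i l hil h ξ hξ)
    refine ⟨g, hg, fun i ξ hξ => ?_⟩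
    by_cases hi : i = i0
    · subst hi
      have h1 := hG i ξ hξ
      have h2 := hg.compLeft_mem _ hξ
      rw [ht] at h1 h2
      have hξ' := hξ
      rw [ht] at hξ'
      rw [hmX, mem_reflect] at h1 h2
      funext γ
      rcases γ with _ | ⟨l, γ⟩
      · rw [h1.1, h2.1]
      · suffices hS : S (k := k) X.M l (G i ξ) = S (k := k) X.M l (g.compLeft (List I) ξ) from
          congrFun hS γ
        by_cases hl : adj i l
        · have hli : l ≠ i := by
            rintro rfl; rcases hp.step hl with h | h <;> omega
          rw [hGS i l hl (by rw [ht, hnb l hl]) ξ hξ, S_compLeft]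
          have := hgG l (S (k := k) Y.M l ξ) (by
            rw [Function.update_of_ne hli, hnb l hl]; exact S_mem hl hξ')
          rwa [Function.update_of_ne hli] at this
        · rw [h1.2.2.1 l hl, h2.2.2.1 l hl]
    · have := hgG i ξ (by rw [Function.update_of_ne hi]; exact hξ)
      rwa [Function.update_of_ne hi] at this
  · push Not at hne
    obtain rfl : q = p := funext fun i => le_antisymm (hne i) (hpq i)
    set g : Y.M →ₗ[k] X.M := ∑ i, LinearMap.proj [] ∘ₗ G i ∘ₗ Y.lift i ∘ₗ Y.e i with hg
    have hga : ∀ {j x}, x ∈ Y.c j → g x = G j (Y.lift j x) [] := by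
      intro j x hx
      rw [hg, LinearMap.sum_apply, Finset.sum_eq_single j]
      · simp [Y.e_self hx]
      · intro i _ hi
        simp [Y.e_ne hi.symm hx]
      · simp
    have hGl : ∀ {j x}, x ∈ Y.c j → ∃ x' ∈ X.c j, G j (Y.lift j x) = X.lift j x' := by
      intro j x hx
      have := hG j (Y.lift j x) (by rw [Y.H_self rfl]; exact ⟨x, hx, rfl⟩)
      rw [X.H_self rfl] at this
      obtain ⟨x', hx', h⟩ := this
      exact ⟨x', hx', h.symm⟩
    have hom : IsHom Y X g := by
      refine ⟨fun {j x} hx => ?_, fun {j l x} hx => ?_⟩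
      · obtain ⟨x', hx', h⟩ := hGl hx
        rw [hga hx, h]; exact hx'
      · obtain ⟨x', hx', h⟩ := hGl hx
        rw [hga (Y.φ_mem l hx), hga hx, h, lift_nil]
        by_cases hl : adj j l ∧ q j = q l + 1
        · rw [← S_lift, ← hGS j l hl.1 hl.2 _ (by rw [Y.H_self rfl]; exact ⟨x, hx, rfl⟩), h]
          rfl
        · rw [Y.φ_zero hl hx, X.φ_zero hl hx', map_zero, map_zero]; rfl
    refine ⟨g, hom, fun i ξ hξ => ?_⟩
    rw [Y.H_self rfl] at hξ
    obtain ⟨x, hx, rfl⟩ := hξ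
    obtain ⟨x', hx', h⟩ := hGl hx
    rw [hom.compLeft_lift hx, hga hx, h, lift_nil]

/-- Morphisms without invertible parts factor through the shifts. -/
theorem exists_sum_S [DecidableEq I] (hp : IsHeight adj p) {f : X.M →ₗ[k] Y.M} (hf : IsHom X Y f)
    (hnil : ∀ g : Y.M →ₗ[k] X.M, IsHom Y X g → IsNilpotent (g ∘ₗ f : Module.End k X.M))
    {t : ℕ} {i : I} {ξ : List I → X.M} (hξ : ξ ∈ X.H t i) :
    f.compLeft (List I) ξ ∈ ⨆ l, ⨆ _ : adj i l, (Y.H (t + 1) l).map (S (k := k) Y.M i) := by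
  by_cases hb : t < p i ∨ t % 2 ≠ p i % 2
  · rw [X.H_bot hb, Submodule.mem_bot] at hξ
    rw [hξ, map_zero]; exact zero_mem _
  push Not at hb
  by_contra hcon
  obtain ⟨u, hu, hker⟩ := Submodule.exists_le_ker_of_notMem hcon
  set lam : (List I → Y.M) →ₗ[k] k := (u (f.compLeft (List I) ξ))⁻¹ • u with hlam
  have hl1 : lam (f.compLeft (List I) ξ) = 1 := by
    simp [hlam, inv_mul_cancel₀ hu]
  have hl0 : ∀ l, adj i l → ∀ η ∈ Y.H (t + 1) l, lam (S (k := k) Y.M i η) = 0 := by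
    intro l hl η hη
    have : u (S (k := k) Y.M i η) = 0 :=
      hker (Submodule.mem_iSup_of_mem l (Submodule.mem_iSup_of_mem hl ⟨η, hη, rfl⟩))
    simp [hlam, this]
  set q : I → ℕ := fun j => if t ≤ p j then p j else if t % 2 = p j % 2 then t else t + 1 with hq
  have hqi : q i = t := by simp only [hq]; split_ifs <;> omega
  obtain ⟨g, hg, hgG⟩ := full (X := X) (Y := Y) hp _ q rfl
    ⟨hp.symm, fun {j l} hjl => by
      have := hp.step hjl
      simp only [hq]; split_ifs <;> omega⟩
    (fun j => by simp only [hq]; split_ifs <;> omega)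
    (fun j => by simp only [hq]; split_ifs <;> omega)
    (fun j => if j = i then lam.smulRight ξ else 0)
    (by
      intro j η hη
      by_cases hj : j = i
      · subst hj
        rw [if_pos rfl, LinearMap.smulRight_apply, hqi]
        exact Submodule.smul_mem _ _ hξ
      · rw [if_neg hj]; exact zero_mem _)
    (by
      intro j l hjl h η hη
      have hstep := hp.step hjl
      by_cases hj : j = i
      · subst hj
        exfalso
        rw [hqi] at h
        simp only [hq] at h
        split_ifs at h <;> omega
      · rw [if_neg hj]
        by_cases hl : l = i
        · subst hl
          rw [if_pos rfl, LinearMap.smulRight_apply, hl0 j (hp.symm hjl) η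
            (by rw [h, hqi] at hη; exact hη)]
          simp
        · rw [if_neg hl]; simp)
  have h1 := hgG i (f.compLeft (List I) ξ) (by rw [hqi]; exact hf.compLeft_mem _ hξ)
  rw [if_pos rfl, LinearMap.smulRight_apply, hl1, one_smul] at h1
  obtain ⟨N, hN⟩ := hnil g hg
  have h2 : ∀ (N : ℕ) γ, ((g ∘ₗ f : Module.End k X.M) ^ N) (ξ γ) = ξ γ := by
    intro N γ
    induction N with
    | zero => rfl
    | succ N ih =>
      rw [pow_succ, Module.End.mul_apply]
      have : (g ∘ₗ f) (ξ γ) = ξ γ := (congrFun h1 γ).symm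
      rw [this, ih]
  have h3 : ξ = 0 := funext fun γ => by rw [← h2 N γ, hN]; rfl
  rw [h3, map_zero] at hl1
  simp at hl1

end QRep

namespace QRep

section Deep

variable {k : Type} [Field k] {I : Type} {adj : I → I → Prop} {p : I → ℕ} [Fintype I]

/-- The elements of `X.H t i` which factor through `m` shifts. -/
def D (X : QRep k adj p) : ℕ → ℕ → ∀ _ : I, Submodule k (List I → X.M)
  | 0, t, i => X.H t i
  | m + 1, t, i => ⨆ l, ⨆ _ : adj i l, (X.D m (t + 1) l).map (S (k := k) X.M i)

variable {X Y Z : QRep k adj p}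

lemma D_le (hp : IsHeight adj p) (m : ℕ) : ∀ t i, X.D m t i ≤ X.H t i := by
  induction m with
  | zero => exact fun t i => le_rfl
  | succ m ih =>
    intro t i
    refine iSup_le fun l => iSup_le fun hl => ?_
    rintro _ ⟨ξ, hξ, rfl⟩
    exact S_mem (hp.symm hl) (ih _ _ hξ)

/-- The maps whose composites with all elements factor through `m` shifts. -/
def Deep (X Y : QRep k adj p) (m : ℕ) (f : X.M →ₗ[k] Y.M) : Prop :=
  ∀ t i, ∀ ξ ∈ X.H t i, f.compLeft (List I) ξ ∈ Y.D m t i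

lemma IsHom.deep_zero {f : X.M →ₗ[k] Y.M} (hf : IsHom X Y f) : Deep X Y 0 f :=
  fun _ _ _ hξ => hf.compLeft_mem _ hξ

lemma Deep.comp [DecidableEq I] (hp : IsHeight adj p) {m : ℕ} {f : X.M →ₗ[k] Y.M}
    {h : Y.M →ₗ[k] Z.M} (hf : IsHom X Y f) (hh : Deep Y Z m h)
    (hnil : ∀ g : Y.M →ₗ[k] X.M, IsHom Y X g → IsNilpotent (g ∘ₗ f : Module.End k X.M)) :
    Deep X Z (m + 1) (h ∘ₗ f) := by
  intro t i ξ hξ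
  have h1 := exists_sum_S hp hf hnil hξ
  change f.compLeft (List I) ξ ∈ (Z.D (m + 1) t i).comap (h.compLeft (List I))
  refine (iSup_le fun l => iSup_le fun hl => ?_ :
    (⨆ l, ⨆ _ : adj i l, (Y.H (t + 1) l).map (S (k := k) Y.M i)) ≤ _) h1
  rintro _ ⟨η, hη, rfl⟩
  exact Submodule.mem_iSup_of_mem l (Submodule.mem_iSup_of_mem hl ⟨_, hh _ _ η hη, rfl⟩)

end Deep

variable {k : Type} [Field k] {n : ℕ}

/-- Adjacency of the Dynkin graph `D_n` on `Fin n`. -/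
abbrev finAdj (n : ℕ) (i l : Fin n) : Prop := Preproj.DAdj n i l

variable {p : Fin n → ℕ} {X : QRep k (finAdj n) p}

/-- The span of all the spaces attached to a vertex. -/
def tot (X : QRep k (finAdj n) p) (i : Fin n) : Submodule k (List (Fin n) → X.M) := ⨆ t, X.H t i

lemma S_mem_tot {i l : Fin n} (hil : finAdj n i l) {ξ : List (Fin n) → X.M} (hξ : ξ ∈ X.tot i) :
    S (k := k) X.M l ξ ∈ X.tot l := by
  change ξ ∈ (X.tot l).comap (S (k := k) X.M l)
  refine (iSup_le fun t => ?_ : X.tot i ≤ _) hξ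
  intro η hη
  rcases t with _ | t
  · change S (k := k) X.M l η ∈ X.tot l
    rw [S_zero hη]; exact zero_mem _
  · exact Submodule.mem_iSup_of_mem t (S_mem hil hη)

lemma S_tot_not_adj {i l : Fin n} (hil : ¬ finAdj n i l) {ξ : List (Fin n) → X.M}
    (hξ : ξ ∈ X.tot i) : S (k := k) X.M l ξ = 0 := by
  have : X.tot i ≤ LinearMap.ker (S (k := k) X.M l) :=
    iSup_le fun t => fun η hη => LinearMap.mem_ker.2 (S_not_adj hil hη)
  exact this hξ

lemma mesh_tot {i : Fin n} {ξ : List (Fin n) → X.M} (hξ : ξ ∈ X.tot i) :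
    ∑ l, S (k := k) X.M i (S (k := k) X.M l ξ) = 0 := by
  have : X.tot i ≤ LinearMap.ker (∑ l, S (k := k) X.M i ∘ₗ S (k := k) X.M l) :=
    iSup_le fun t => by
      intro η hη
      rw [LinearMap.mem_ker, LinearMap.sum_apply]; exact mesh hη
  have := this hξ
  rwa [LinearMap.mem_ker, LinearMap.sum_apply] at this

/-- The shift between the total spaces. -/
def shift (X : QRep k (finAdj n) p) {i l : Fin n} (h : finAdj n i l) : X.tot i →ₗ[k] X.tot l :=
  (S (k := k) X.M l).restrict (p := X.tot i) (q := X.tot l) fun _ hξ => S_mem_tot h hξ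

/-- The action of an arrow of the double quiver on the sum of all the spaces. -/
noncomputable def act (X : QRep k (finAdj n) p) (l i : ℕ) : Module.End k (∀ i, X.tot i) :=
  if h : ∃ (hl : l < n) (hi : i < n), finAdj n ⟨i, hi⟩ ⟨l, hl⟩ then
    (LinearMap.single k (fun i => X.tot i) ⟨l, h.1⟩).comp
      ((X.shift h.2.2).comp (LinearMap.proj (R := k) (φ := fun i => X.tot i) ⟨i, h.2.1⟩))
  else 0

lemma act_apply {l i : Fin n} (m : ∀ i, X.tot i) :
    ((X.act l i m) l : List (Fin n) → X.M) = S (k := k) X.M l (m i) := by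
  unfold act
  split_ifs with h
  · obtain ⟨-, -, h⟩ := h
    simp [shift]
  · rw [S_tot_not_adj (fun h' => h ⟨l.2, i.2, h'⟩) (m i).2]
    rfl

lemma act_apply_of_ne {l j : Fin n} {i : ℕ} (hlj : j ≠ l) (m : ∀ i, X.tot i) :
    (X.act l i m) j = 0 := by
  unfold act
  split_ifs with h
  · simp [Pi.single_eq_of_ne hlj]
  · rfl

lemma act_single {l i : Fin n} (ξ : X.tot i) (hS : S (k := k) X.M l ξ ∈ X.tot l) :
    X.act l i (Pi.single i ξ) = Pi.single l ⟨_, hS⟩ := by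
  funext j
  by_cases hj : j = l
  · subst hj
    apply Subtype.ext
    rw [act_apply, Pi.single_eq_same, Pi.single_eq_same]
  · rw [act_apply_of_ne hj, Pi.single_eq_of_ne hj]

lemma sum_act (i : Fin n) : ∑ l : Fin n, X.act i l * X.act l i = 0 := by
  ext1 j
  ext1 ξ
  funext i'
  apply Subtype.ext
  simp only [LinearMap.comp_apply, LinearMap.sum_apply, Finset.sum_apply, Module.End.mul_apply,
    AddSubmonoidClass.coe_finsetSum, LinearMap.zero_apply, Pi.zero_apply, ZeroMemClass.coe_zero]
  by_cases hi : i' = i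
  · subst hi
    simp only [act_apply]
    exact mesh_tot (SetLike.coe_mem _)
  · exact Finset.sum_eq_zero fun l _ => by rw [act_apply_of_ne hi]; rfl

lemma act_not_adj {l i : ℕ} (h : ¬ Preproj.DAdj n l i) : X.act l i = 0 := by
  unfold act
  rw [dif_neg]
  rintro ⟨hl, hi, h'⟩
  exact h (by unfold finAdj Preproj.DAdj at *; simp only at h'; omega)

lemma rel_act (hn : 4 ≤ n) : Preproj.Rel n X.act where
  supp l i h := act_not_adj h
  end0 := by
    have := sum_act (X := X) ⟨0, by omega⟩
    rwa [Finset.sum_eq_single ⟨2, by omega⟩] at this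
    · intro l _ hl
      rw [act_not_adj (l := 0), zero_mul]
      unfold Preproj.DAdj
      have : (l : ℕ) ≠ 2 := fun h => hl (Fin.ext h)
      omega
    · simp
  end1 := by
    have := sum_act (X := X) ⟨1, by omega⟩
    rwa [Finset.sum_eq_single ⟨2, by omega⟩] at this
    · intro l _ hl
      rw [act_not_adj (l := 1), zero_mul]
      unfold Preproj.DAdj
      have : (l : ℕ) ≠ 2 := fun h => hl (Fin.ext h)
      omega
    · simp
  mid := by
    have := sum_act (X := X) ⟨2, by omega⟩
    rw [← Finset.sum_subset (Finset.subset_univ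
      {(⟨0, by omega⟩ : Fin n), ⟨1, by omega⟩, ⟨3, by omega⟩})] at this
    · rw [Finset.sum_insert (by simp), Finset.sum_insert (by simp), Finset.sum_singleton] at this
      rw [add_assoc]; exact this
    · intro l _ hl
      rw [act_not_adj (l := 2), zero_mul]
      unfold Preproj.DAdj
      simp only [Finset.mem_insert, Finset.mem_singleton, Fin.ext_iff] at hl
      omega
  arm j hj := by
    by_cases h1 : j + 1 < n
    · have := sum_act (X := X) ⟨j + 1, h1⟩
      by_cases h2 : j + 2 < n
      · rw [← Finset.sum_subset (Finset.subset_univ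
          {(⟨j, by omega⟩ : Fin n), ⟨j + 2, by omega⟩})] at this
        · rw [Finset.sum_insert (by simp), Finset.sum_singleton] at this
          exact this
        · intro l _ hl
          rw [act_not_adj (l := j + 1), zero_mul]
          unfold Preproj.DAdj
          simp only [Finset.mem_insert, Finset.mem_singleton, Fin.ext_iff] at hl
          omega
      · rw [Finset.sum_eq_single ⟨j, by omega⟩] at this
        · rw [act_not_adj (l := j + 1) (i := j + 2) (by unfold Preproj.DAdj; omega), zero_mul,
            add_zero]
          exact this
        · intro l _ hl
          rw [act_not_adj (l := j + 1), zero_mul]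
          unfold Preproj.DAdj
          have : (l : ℕ) ≠ j := fun h => hl (Fin.ext h)
          omega
        · simp
    · rw [act_not_adj (l := j + 1) (i := j) (by unfold Preproj.DAdj; omega),
        act_not_adj (l := j + 1) (i := j + 2) (by unfold Preproj.DAdj; omega), zero_mul, zero_mul,
        add_zero]

lemma mem_tot {t : ℕ} {i : Fin n} {ξ : List (Fin n) → X.M} (h : ξ ∈ X.H t i) : ξ ∈ X.tot i :=
  Submodule.mem_iSup_of_mem t h

lemma apply_single_eq_zero (hp : IsHeight (finAdj n) p) (m : ℕ) :
    ∀ (t : ℕ) (i : Fin n) (ξ : List (Fin n) → X.M), ξ ∈ X.D m t i → ∀ h : ξ ∈ X.tot i,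
    ∀ ρ : Module.End k (∀ i, X.tot i),
    (∀ j < n, ∀ r, Preproj.Path n X.act m j i r → ρ * r = 0) → ρ (Pi.single i ⟨ξ, h⟩) = 0 := by
  induction m with
  | zero =>
    intro t i ξ _ h ρ hρ
    have := hρ i i.2 1 (.nil _)
    rw [mul_one] at this
    rw [this]; rfl
  | succ m ih =>
    intro t i ξ hξ h ρ hρ
    set N : Submodule k (List (Fin n) → X.M) :=
      (LinearMap.ker (ρ ∘ₗ LinearMap.single k (fun i => X.tot i) i)).map (X.tot i).subtype with hN
    have key : X.D (m + 1) t i ≤ N := by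
      refine iSup_le fun l => iSup_le fun hl => ?_
      rintro _ ⟨η, hη, rfl⟩
      have hli : finAdj n l i := by unfold finAdj Preproj.DAdj at *; omega
      have hηt := mem_tot (D_le hp _ _ _ hη)
      have h1 := ih (t + 1) l η hη hηt (ρ * X.act i l) (fun j hj r hr => by
        rw [mul_assoc]; exact hρ j hj _ (.cons hl hr))
      rw [Module.End.mul_apply, act_single _ (S_mem_tot hli hηt)] at h1
      exact ⟨⟨_, S_mem_tot hli hηt⟩, h1, rfl⟩
    obtain ⟨⟨ξ', h'⟩, h1, h2⟩ := key hξ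
    simp only [Submodule.subtype_apply] at h2
    subst h2
    exact h1

/-- In type `D_n` no nonzero element factors through `2 * n - 3` shifts. -/
theorem D_eq_bot (hp : IsHeight (finAdj n) p) (hn : 4 ≤ n) (t : ℕ) (i : Fin n) :
    X.D (2 * n - 3) t i = ⊥ := by
  rw [eq_bot_iff]
  intro ξ hξ
  have h1 := apply_single_eq_zero hp _ t i ξ hξ (mem_tot (D_le hp _ _ _ hξ)) 1
    (fun j hj r hr => by rw [hr.eq_zero (rel_act hn) hn hj, mul_zero])
  have h2 := congrFun h1 i
  rw [Module.End.one_apply, Pi.single_eq_same] at h2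
  exact congrArg Subtype.val h2

/-- A composite of `2 * n - 3` maps without invertible parts vanishes. -/
theorem Deep.eq_zero {Y : QRep k (finAdj n) p} (hp : IsHeight (finAdj n) p) (hn : 4 ≤ n)
    {f : X.M →ₗ[k] Y.M} (hf : Deep X Y (2 * n - 3) f) {i : Fin n} {x : X.M} (hx : x ∈ X.c i) :
    f x = 0 := by
  have := hf (p i) i (X.lift i x) (by rw [X.H_self rfl]; exact ⟨x, hx, rfl⟩)
  rw [D_eq_bot hp hn, Submodule.mem_bot] at this
  exact congrFun this []

end QRep

open QRep (finAdj)

section Label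

variable {k A V E : Type} [Field k] [Ring A] [Algebra k A] [Fintype V] [Fintype E]

/-- A labelling of a quiver of type `D_n` by the standard vertices, with a compatible height. -/
structure IsLabel (P : QuiverPresentation k A V E) (n : ℕ) (v : Fin n ≃ V) (p : Fin n → ℕ) :
    Prop where
  height : IsHeight (finAdj n) p
  le : ∀ j, n ≤ p j
  arr : ∀ α, ∃ i l, P.src α = v i ∧ P.tgt α = v l ∧ finAdj n i l ∧ p i = p l + 1
  ex : ∀ i l, finAdj n i l → p i = p l + 1 → ∃ α, P.src α = v i ∧ P.tgt α = v l
  uniq : ∀ α β, P.src α = P.src β → P.tgt α = P.tgt β → α = β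

lemma exists_height (n : ℕ) (s : ℕ → Prop) : ∃ p : ℕ → ℕ, (∀ j < n, n ≤ p j) ∧
    (∀ j, j = 0 ∨ j = 1 → (s j → p j = p 2 + 1) ∧ (¬ s j → p 2 = p j + 1)) ∧
    ∀ j, 2 ≤ j → j + 1 < n → (s j → p j = p (j + 1) + 1) ∧ (¬ s j → p (j + 1) = p j + 1) := by
  let r : ℕ → ℕ := fun j => Nat.rec (4 * n + 4) (fun j a => if s (j + 2) then a - 1 else a + 1) j
  have r0 : r 0 = 4 * n + 4 := rfl
  have rs : ∀ j, r (j + 1) = if s (j + 2) then r j - 1 else r j + 1 := fun j => rfl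
  have hr : ∀ j, 4 * n + 4 ≤ r j + j := by
    intro j
    induction j with
    | zero => simp [r0]
    | succ j ih => rw [rs]; split_ifs <;> omega
  let p : ℕ → ℕ := fun j => if j < 2 then (if s j then r 0 + 1 else r 0 - 1) else r (j - 2)
  have p2 : p 2 = 4 * n + 4 := rfl
  have pl : ∀ j, j < 2 → p j = if s j then r 0 + 1 else r 0 - 1 := fun j hj => if_pos hj
  have pg : ∀ j, 2 ≤ j → p j = r (j - 2) := fun j hj => if_neg (by omega)
  refine ⟨p, fun j hj => ?_, fun j hj => ?_, fun j hj hj' => ?_⟩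
  · by_cases h : j < 2
    · rw [pl j h]; split_ifs <;> omega
    · rw [pg j (by omega)]
      have := hr (j - 2)
      omega
  · rw [pl j (by omega), p2, r0]
    constructor <;> intro h <;> simp [h]
  · rw [pg j hj, pg (j + 1) (by omega), show j + 1 - 2 = (j - 2) + 1 by omega, rs,
      show j - 2 + 2 = j by omega]
    have := hr (j - 2)
    constructor <;> intro h
    · rw [if_pos h]; omega
    · rw [if_neg h]

theorem exists_isLabel (P : QuiverPresentation k A V E) {n : ℕ} (hn : 4 ≤ n)
    (h : P.GraphSpec n (n - 1) (typeDEnds n)) :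
    ∃ (v : Fin n ≃ V) (p : Fin n → ℕ), IsLabel P n v p := by
  obtain ⟨v, ar, hva⟩ := h
  let s : ℕ → Prop := fun e => ∃ (he : e < n - 1) (a : Fin n),
    (a : ℕ) = (typeDEnds n ⟨e, he⟩).1 ∧ P.src (ar ⟨e, he⟩) = v a
  obtain ⟨p, hp1, hp2, hp3⟩ := exists_height n s
  have ends : ∀ e : Fin (n - 1), typeDEnds n e = if (e : ℕ) = 0 then (0, 2) else
    if (e : ℕ) = 1 then (1, 2) else ((e : ℕ), (e : ℕ) + 1) := fun e => rfl
  have key : ∀ e : Fin (n - 1), ∃ i l : Fin n, P.src (ar e) = v i ∧ P.tgt (ar e) = v l ∧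
      p i = p l + 1 ∧ (((i : ℕ) = (typeDEnds n e).1 ∧ (l : ℕ) = (typeDEnds n e).2) ∨
        ((l : ℕ) = (typeDEnds n e).1 ∧ (i : ℕ) = (typeDEnds n e).2)) := by
    intro e
    obtain ⟨a, b, ha, hb, hab⟩ := hva e
    have hne : a ≠ b := by
      rintro rfl
      rw [ha, ends] at hb
      split_ifs at hb <;> simp at hb
    have hst : (s e → p a = p b + 1) ∧ (¬ s e → p b = p a + 1) := by
      rw [ha, hb, ends]
      split_ifs with h0 h1
      · rw [h0]; exact hp2 0 (.inl rfl)
      · rw [h1]; exact hp2 1 (.inr rfl)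
      · exact hp3 e (by omega) (by omega)
    rcases hab with ⟨h1, h2⟩ | ⟨h1, h2⟩
    · exact ⟨a, b, h1, h2, hst.1 ⟨e.2, a, ha, h1⟩, .inl ⟨ha, hb⟩⟩
    · refine ⟨b, a, h1, h2, hst.2 ?_, .inr ⟨ha, hb⟩⟩
      rintro ⟨_, a', ha', h3⟩
      have h4 : v b = v a' := h1.symm.trans h3
      have h5 := v.injective h4
      exact hne (Fin.ext (by rw [ha, h5, ha']))
  have hadj : ∀ i l : Fin n, finAdj n i l → ∃ e : Fin (n - 1),
      (((i : ℕ) = (typeDEnds n e).1 ∧ (l : ℕ) = (typeDEnds n e).2) ∨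
        ((l : ℕ) = (typeDEnds n e).1 ∧ (i : ℕ) = (typeDEnds n e).2)) := by
    intro i l hil
    unfold finAdj Preproj.DAdj at hil
    have : ∃ e : ℕ, e < n - 1 ∧
        (((i : ℕ) = (if e = 0 then (0, 2) else if e = 1 then (1, 2) else (e, e + 1)).1 ∧
        (l : ℕ) = (if e = 0 then (0, 2) else if e = 1 then (1, 2) else (e, e + 1)).2) ∨
        ((l : ℕ) = (if e = 0 then (0, 2) else if e = 1 then (1, 2) else (e, e + 1)).1 ∧
        (i : ℕ) = (if e = 0 then (0, 2) else if e = 1 then (1, 2) else (e, e + 1)).2)) := by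
      rcases hil with ⟨hi, hl, h | h | h | h | h | h⟩
      · exact ⟨0, by omega, by simp [h]⟩
      · exact ⟨0, by omega, by simp [h]⟩
      · exact ⟨1, by omega, by simp [h]⟩
      · exact ⟨1, by omega, by simp [h]⟩
      · refine ⟨i, by omega, ?_⟩
        rw [if_neg (by omega), if_neg (by omega)]
        simp [h]
      · refine ⟨l, by omega, ?_⟩
        rw [if_neg (by omega), if_neg (by omega)]
        simp [h]
    obtain ⟨e, he, h⟩ := this
    exact ⟨⟨e, he⟩, h⟩
  have hinj : ∀ e e' : Fin (n - 1), (((typeDEnds n e).1 = (typeDEnds n e').1 ∧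
      (typeDEnds n e).2 = (typeDEnds n e').2) ∨ ((typeDEnds n e).1 = (typeDEnds n e').2 ∧
      (typeDEnds n e).2 = (typeDEnds n e').1)) → e = e' := by
    intro e e' h
    rw [ends, ends] at h
    apply Fin.ext
    split_ifs at h <;> simp at h <;> omega
  have hst : ∀ i l : Fin n, finAdj n i l → p i = p l + 1 ∨ p l = p i + 1 := by
    intro i l hil
    obtain ⟨e, he⟩ := hadj i l hil
    obtain ⟨i', l', -, -, h3, h4⟩ := key e
    rcases he with he | he <;> rcases h4 with h4 | h4
    · obtain rfl : i = i' := Fin.ext (by omega)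
      obtain rfl : l = l' := Fin.ext (by omega)
      exact .inl h3
    · obtain rfl : i = l' := Fin.ext (by omega)
      obtain rfl : l = i' := Fin.ext (by omega)
      exact .inr h3
    · obtain rfl : i = l' := Fin.ext (by omega)
      obtain rfl : l = i' := Fin.ext (by omega)
      exact .inr h3
    · obtain rfl : i = i' := Fin.ext (by omega)
      obtain rfl : l = l' := Fin.ext (by omega)
      exact .inl h3
  refine ⟨v, fun j => p j, ⟨?_, ?_⟩, fun j => hp1 j j.2, ?_, ?_, ?_⟩
  · intro i l h
    unfold finAdj Preproj.DAdj at *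
    omega
  · exact fun {i l} h => hst i l h
  · intro α
    obtain ⟨e, rfl⟩ := ar.surjective α
    obtain ⟨i, l, h1, h2, h3, h4⟩ := key e
    refine ⟨i, l, h1, h2, ?_, h3⟩
    have := i.2
    have := l.2
    rw [ends] at h4
    unfold finAdj Preproj.DAdj
    split_ifs at h4 <;> simp at h4 <;> omega
  · intro i l hil hpp
    obtain ⟨e, he⟩ := hadj i l hil
    obtain ⟨i', l', h1, h2, h3, h4⟩ := key e
    have : i = i' ∧ l = l' := by
      by_cases h : (i : ℕ) = i'
      · exact ⟨Fin.ext h, Fin.ext (by omega)⟩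
      · exfalso
        obtain rfl : i = l' := Fin.ext (by omega)
        obtain rfl : l = i' := Fin.ext (by omega)
        omega
    exact ⟨ar e, by rw [h1, this.1], by rw [h2, this.2]⟩
  · intro α β h1 h2
    obtain ⟨e, rfl⟩ := ar.surjective α
    obtain ⟨e', rfl⟩ := ar.surjective β
    congr 1
    obtain ⟨i, l, g1, g2, g3, g4⟩ := key e
    obtain ⟨i', l', g1', g2', g3', g4'⟩ := key e'
    have hi : i = i' := v.injective (by rw [← g1, ← g1', h1])
    have hl : l = l' := v.injective (by rw [← g2, ← g2', h2])
    subst hi hl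
    exact hinj e e' (by omega)

end Label

section RadNilpotent

variable {A : Type} [Ring A]

/-- A non-zero artinian module has an indecomposable direct summand. -/
lemma exists_indec_range (R : Type) [AddCommGroup R] [Module A R] [IsArtinian A R] [Nontrivial R] :
    ∃ e : R →ₗ[A] R, (∀ x, e (e x) = e x) ∧ Indec A (ModuleCat.of A (LinearMap.range e)) := by
  obtain ⟨N, ⟨hN, e, he, rfl⟩, hmin⟩ := IsArtinian.set_has_minimal
    {N : Submodule A R | N ≠ ⊥ ∧ ∃ e : R →ₗ[A] R, (∀ x, e (e x) = e x) ∧ LinearMap.range e = N}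
    ⟨⊤, top_ne_bot, LinearMap.id, fun _ => rfl, LinearMap.range_id⟩
  refine ⟨e, he, (Submodule.nontrivial_iff_ne_bot.2 hN : Nontrivial (LinearMap.range e)),
    fun f hf => ?_⟩
  have hf' : ∀ x : LinearMap.range e, f.hom (f.hom x) = f.hom x := fun x =>
    LinearMap.congr_fun (congrArg ModuleCat.Hom.hom hf) x
  have hee : ∀ x : LinearMap.range e, e.rangeRestrict x = x := by
    rintro ⟨_, y, rfl⟩
    exact Subtype.ext (he y)
  let e' : R →ₗ[A] R := (LinearMap.range e).subtype ∘ₗ f.hom ∘ₗ e.rangeRestrict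
  have he'a : ∀ x, e' x = (f.hom (e.rangeRestrict x) : LinearMap.range e) := fun _ => rfl
  have he' : ∀ x, e' (e' x) = e' x := fun x => by
    rw [he'a, he'a, hee, hf']
  by_cases h0 : LinearMap.range e' = ⊥
  · left
    ext x
    have h1 : e' (x : LinearMap.range e) = 0 := LinearMap.congr_fun (LinearMap.range_eq_bot.1 h0) _
    rw [he'a, hee] at h1
    exact h1
  · right
    have hle : LinearMap.range e' ≤ LinearMap.range e := by
      rintro _ ⟨x, rfl⟩
      exact Subtype.prop _
    have heq : LinearMap.range e ≤ LinearMap.range e' := by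
      by_contra hne
      exact hmin _ ⟨h0, e', he', rfl⟩ (lt_of_le_not_ge hle hne)
    ext x
    obtain ⟨y, hy⟩ := heq (Subtype.prop (x : LinearMap.range e))
    have h1 : e' (x : LinearMap.range e) = (x : LinearMap.range e) := by rw [← hy, he']
    rw [he'a, hee] at h1
    exact h1

variable [IsArtinianRing A]

lemma isNilpotent_of_mem_radSet {X Y : ModuleCat.{0} A} [Module.Finite A X] {f : X ⟶ Y}
    (hf : f ∈ radSet A X Y) (g : Y ⟶ X) : IsNilpotent (g.hom ∘ₗ f.hom : Module.End A X) := by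
  have : IsArtinian A X := isArtinian_of_fg_of_artinian'
  have : IsNoetherian A X := isNoetherian_of_isNoetherianRing_of_finite A X
  by_contra hnil
  set φ : Module.End A X := g.hom ∘ₗ f.hom with hφ
  obtain ⟨N₀, hN₀⟩ := Filter.eventually_atTop.1 φ.eventually_iInf_range_pow_eq
  set N := N₀ + 1 with hN
  have hR : LinearMap.range (φ ^ N) = LinearMap.range (φ ^ (N + N)) := by
    rw [← hN₀ N (by omega), ← hN₀ (N + N) (by omega)]
  set R := LinearMap.range (φ ^ N) with hRdef
  have hnt : Nontrivial R := by
    rw [Submodule.nontrivial_iff_ne_bot]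
    exact fun h => hnil ⟨N, LinearMap.range_eq_bot.1 h⟩
  let ψ : R →ₗ[A] R := (φ ^ N).rangeRestrict ∘ₗ R.subtype
  have hψs : Function.Surjective ψ := by
    rintro ⟨x, hx⟩
    rw [hR] at hx
    obtain ⟨y, rfl⟩ := hx
    refine ⟨⟨(φ ^ N) y, y, rfl⟩, Subtype.ext ?_⟩
    exact (LinearMap.congr_fun (pow_add φ N N) y).symm
  have hψi : Function.Injective ψ := IsNoetherian.injective_of_surjective_endomorphism ψ hψs
  let Ψ : R ≃ₗ[A] R := LinearEquiv.ofBijective ψ ⟨hψi, hψs⟩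
  obtain ⟨e, he, hM⟩ := exists_indec_range (A := A) R
  have hfin : Module.Finite A (LinearMap.range e) := inferInstance
  refine hf (ModuleCat.of A (LinearMap.range e)) ⟨hfin, hM⟩
    (ModuleCat.ofHom (R.subtype ∘ₗ (LinearMap.range e).subtype))
    (ModuleCat.ofHom (e.rangeRestrict ∘ₗ Ψ.symm.toLinearMap ∘ₗ Ψ.symm.toLinearMap ∘ₗ
      (φ ^ N).rangeRestrict ∘ₗ (φ ^ N₀) ∘ₗ g.hom)) ?_
  convert IsIso.id (ModuleCat.of A (LinearMap.range e))
  ext x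
  obtain ⟨x, y, rfl⟩ := (x : LinearMap.range e)
  change ((e (Ψ.symm (Ψ.symm ((φ ^ N).rangeRestrict ((φ ^ N₀) (φ (e y)))))) : R) : X) = ((e y : R) : X)
  have : (φ ^ N).rangeRestrict ((φ ^ N₀) (φ (e y))) = Ψ (Ψ (e y)) := by
    apply Subtype.ext
    change (φ ^ N) ((φ ^ N₀ * φ) (e y)) = (φ ^ N) ((φ ^ N) (e y))
    rw [← pow_succ]
  rw [this, LinearEquiv.symm_apply_apply, LinearEquiv.symm_apply_apply, he]

end RadNilpotent

namespace IsLabel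

variable {k A V E : Type} [Field k] [Ring A] [Algebra k A] [Fintype V] [Fintype E]
  {P : QuiverPresentation k A V E} {n : ℕ} {v : Fin n ≃ V} {p : Fin n → ℕ}

lemma sum_idem_smul (P : QuiverPresentation k A V E) (v : Fin n ≃ V) {X : Type} [AddCommGroup X]
    [Module A X] (x : X) : ∑ j, P.idem (v j) • x = x := by
  rw [← Finset.sum_smul, v.sum_comp P.idem, P.sum_idem, one_smul]

section

variable (hL : IsLabel P n v p)
  (X : Type) [AddCommGroup X] [Module k X] [Module A X] [IsScalarTower k A X]

/-- The representation of the labelled quiver given by a module. -/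
noncomputable abbrev toRep : QRep k (finAdj n) p where
  M := X
  c j := LinearMap.eqLocus (Algebra.lsmul k k X (P.idem (v j))) LinearMap.id
  φ i l := ∑ α, if P.src α = v i ∧ P.tgt α = v l then Algebra.lsmul k k X (P.arrow α) else 0
  e j := Algebra.lsmul k k X (P.idem (v j))
  e_self h := h
  e_ne {i j x} hij hx := by
    have h : P.idem (v i) • x = x := hx
    change P.idem (v j) • x = 0
    rw [← h, smul_smul, P.idem_orth _ _ (fun h => hij (v.injective h).symm), zero_smul]
  φ_mem {i x} l _ := by
    change P.idem (v l) • (_ : X) = _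
    rw [LinearMap.sum_apply, Finset.smul_sum]
    refine Finset.sum_congr rfl fun α _ => ?_
    split_ifs with h
    · change P.idem (v l) • P.arrow α • x = P.arrow α • x
      rw [smul_smul, ← h.2, ← P.arrow_mem α, ← mul_assoc, ← mul_assoc, P.idem_idem]
    · simp
  φ_zero {i l x} h _ := by
    rw [LinearMap.sum_apply]
    refine Finset.sum_eq_zero fun α _ => ?_
    rw [if_neg, LinearMap.zero_apply]
    rintro ⟨h1, h2⟩
    obtain ⟨i', l', h3, h4, h5⟩ := hL.arr α
    obtain rfl := v.injective (h1.symm.trans h3)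
    obtain rfl := v.injective (h2.symm.trans h4)
    exact h h5

variable {X}

lemma mem_toRep_c {j : Fin n} {x : X} : x ∈ (hL.toRep X).c j ↔ P.idem (v j) • x = x := Iff.rfl

lemma toRep_φ {i l : Fin n} {α : E} (h1 : P.src α = v i) (h2 : P.tgt α = v l) (x : X) :
    (hL.toRep X).φ i l x = P.arrow α • x := by
  change (∑ α, if P.src α = v i ∧ P.tgt α = v l then Algebra.lsmul k k X (P.arrow α) else 0) x = _
  rw [LinearMap.sum_apply, Finset.sum_eq_single α, if_pos ⟨h1, h2⟩]
  · rfl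
  · intro β _ hβ
    rw [if_neg, LinearMap.zero_apply]
    rintro ⟨h3, h4⟩
    exact hβ (hL.uniq _ _ (h3.trans h1.symm) (h4.trans h2.symm))
  · simp

lemma idem_smul_mem (j : Fin n) (x : X) : P.idem (v j) • x ∈ (hL.toRep X).c j := by
  rw [mem_toRep_c, smul_smul, P.idem_idem]

variable {Y : Type} [AddCommGroup Y] [Module k Y] [Module A Y] [IsScalarTower k A Y]

lemma isHom_restrictScalars (f : X →ₗ[A] Y) :
    QRep.IsHom (hL.toRep X) (hL.toRep Y) (f.restrictScalars k) where
  mem {i x} hx := by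
    change P.idem (v i) • f x = f x
    rw [← map_smul, hL.mem_toRep_c.1 hx]
  comm {i l x} _ := by
    change f ((∑ α, if P.src α = v i ∧ P.tgt α = v l then
      Algebra.lsmul k k X (P.arrow α) else 0) x) = (∑ α, if P.src α = v i ∧ P.tgt α = v l then
      Algebra.lsmul k k Y (P.arrow α) else 0) (f x)
    rw [LinearMap.sum_apply, LinearMap.sum_apply, map_sum]
    refine Finset.sum_congr rfl fun α _ => ?_
    split_ifs
    · exact map_smul f _ _
    · simp

lemma map_smul_of_isHom {f : X →ₗ[k] Y} (hf : QRep.IsHom (hL.toRep X) (hL.toRep Y) f) (a : A)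
    (x : X) : f (a • x) = a • f x := by
  have hidem : ∀ j x, f (P.idem (v j) • x) = P.idem (v j) • f x := by
    intro j x
    conv_rhs => rw [← sum_idem_smul P v x, map_sum, Finset.smul_sum]
    rw [Finset.sum_eq_single j]
    · exact (hf.mem (hL.idem_smul_mem j x)).symm
    · intro i _ hij
      have := hf.mem (hL.idem_smul_mem i x)
      exact (hL.toRep Y).e_ne hij this
    · simp
  have ha : a ∈ Algebra.adjoin k (Set.range P.idem ∪ Set.range P.arrow) := by
    rw [P.generates]; trivial
  induction ha using Algebra.adjoin_induction generalizing x with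
  | mem a ha =>
    rcases ha with ⟨j, rfl⟩ | ⟨α, rfl⟩
    · obtain ⟨j, rfl⟩ := v.surjective j
      exact hidem j x
    · obtain ⟨i, l, h1, h2, -⟩ := hL.arr α
      have h3 : P.arrow α * P.idem (v i) = P.arrow α := by
        rw [← h1, ← P.arrow_mem α, mul_assoc, P.idem_idem]
      rw [← h3, mul_smul, ← hL.toRep_φ h1 h2]
      refine (hf.comm (hL.idem_smul_mem i x)).trans ?_
      rw [hL.toRep_φ h1 h2, hidem, mul_smul]
  | algebraMap r => simp
  | add a b _ _ ha hb => rw [add_smul, map_add, ha, hb, add_smul]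
  | mul a b _ _ ha hb => rw [mul_smul, ha, hb, mul_smul]

end

section

open scoped ModuleCat.Algebra

variable [FiniteDimensional k A]

attribute [local instance] ModuleCat.moduleOfAlgebraModule
  ModuleCat.isScalarTower_of_algebra_moduleCat

lemma deep_of_mem_radPowSet (hL : IsLabel P n v p) (m : ℕ) : ∀ {X Y : ModuleCat.{0} A}
    [Module.Finite A X] {f : X ⟶ Y}, f ∈ radPowSet A m X Y →
    QRep.Deep (hL.toRep X) (hL.toRep Y) m (f.hom.restrictScalars k) := by
  have : IsArtinianRing A := IsArtinianRing.of_finite k A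
  induction m with
  | zero => exact fun _ => (hL.isHom_restrictScalars _).deep_zero
  | succ m ih =>
    intro X Y _ f hf
    obtain ⟨M, g, h, hM, hg, hh, rfl⟩ := hf
    refine QRep.Deep.comp hL.height (hL.isHom_restrictScalars g.hom) (ih hh) fun g' hg' => ?_
    let G : M ⟶ X := ModuleCat.ofHom
      { toFun := g', map_add' := map_add g', map_smul' := hL.map_smul_of_isHom hg' }
    obtain ⟨N, hN⟩ := isNilpotent_of_mem_radSet hg G
    refine ⟨N, LinearMap.ext fun x => ?_⟩
    have : ∀ N x, ((g' ∘ₗ g.hom.restrictScalars k : Module.End k X) ^ N) x =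
        ((G.hom ∘ₗ g.hom : Module.End A X) ^ N) x := by
      intro N
      induction N with
      | zero => intro x; rfl
      | succ N ih => intro x; rw [pow_succ, pow_succ]; exact ih _
    exact (this N x).trans (LinearMap.congr_fun hN x)

theorem radVanishes (hL : IsLabel P n v p) (hn : 4 ≤ n) : RadVanishes A (2 * n - 3) := by
  intro X Y _ _ f hf
  have h := hL.deep_of_mem_radPowSet _ hf
  ext x
  rw [← sum_idem_smul P v x, map_sum, map_sum]
  exact Finset.sum_congr rfl fun j _ => h.eq_zero hL.height hn (hL.idem_smul_mem j x)

end

end IsLabel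

/-- The products of arrows along the paths of a quiver, in a ring with elements attached to
the vertices and to the arrows. -/
inductive PathElt {B V E : Type} [Mul B] (src tgt : E → V) (ε : V → B) (a : E → B) :
    V → V → B → Prop
  | nil (i : V) : PathElt src tgt ε a i i (ε i)
  | cons {i j l : V} {b : B} (h : PathElt src tgt ε a i j b) (α : E) (hs : src α = j)
    (ht : tgt α = l) : PathElt src tgt ε a i l (a α * b)

namespace PathElt

variable {B V E : Type} {src tgt : E → V}

lemma map {B' : Type} [Ring B] [Ring B'] {ε : V → B} {a : E → B} (f : B →+* B') {i j : V} {b : B}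
    (h : PathElt src tgt ε a i j b) :
    PathElt src tgt (fun i => f (ε i)) (fun α => f (a α)) i j (f b) := by
  induction h with
  | nil => exact .nil _
  | cons _ α hs ht ih => rw [map_mul]; exact .cons ih α hs ht

section

variable {k : Type} [Field k] [Ring B] [Algebra k B] [Fintype V] {ε : V → B} {a : E → B}

/-- A complete family of orthogonal idempotents with elements attached to the arrows. -/
structure IsFamily (src tgt : E → V) (ε : V → B) (a : E → B) : Prop where
  idem : ∀ i, ε i * ε i = ε i
  orth : ∀ i j, i ≠ j → ε i * ε j = 0
  sum : ∑ i, ε i = 1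
  left : ∀ α, ε (tgt α) * a α = a α
  right : ∀ α, a α * ε (src α) = a α

lemma idem_mul (hε : IsFamily src tgt ε a) {i j : V} {b : B} (h : PathElt src tgt ε a i j b) : ε j * b = b := by
  cases h with
  | nil => exact hε.idem _
  | cons h α hs ht => subst ht; rw [← mul_assoc, hε.left]

lemma mul_idem (hε : IsFamily src tgt ε a) {i j : V} {b : B} (h : PathElt src tgt ε a i j b) : b * ε i = b := by
  induction h with
  | nil => exact hε.idem _
  | cons h α hs ht ih => rw [mul_assoc, ih]

lemma mem_span (hε : IsFamily src tgt ε a) {x : B}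
    (hx : x ∈ Algebra.adjoin k (Set.range ε ∪ Set.range a)) :
    x ∈ Submodule.span k {b | ∃ i j, PathElt src tgt ε a i j b} := by
  set U := Submodule.span k {b | ∃ i j, PathElt src tgt ε a i j b} with hU
  suffices h : ∀ y ∈ U, x * y ∈ U by
    rw [← mul_one x, ← hε.sum]
    exact h _ (sum_mem fun i _ => Submodule.subset_span ⟨i, i, .nil i⟩)
  have gen : ∀ z : B, (∀ b i j, PathElt src tgt ε a i j b → z * b ∈ U) → ∀ y ∈ U, z * y ∈ U := by
    intro z hz y hy
    exact (Submodule.span_le.2 (by rintro b ⟨i, j, h⟩; exact hz b i j h) :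
      U ≤ U.comap (LinearMap.mulLeft k z)) hy
  induction hx using Algebra.adjoin_induction with
  | mem x hx =>
    refine gen x fun b i j hb => ?_
    rcases hx with ⟨l, rfl⟩ | ⟨α, rfl⟩
    · by_cases h : l = j
      · subst h; rw [idem_mul hε hb]; exact Submodule.subset_span ⟨i, l, hb⟩
      · rw [← idem_mul hε hb, ← mul_assoc, hε.orth _ _ h, zero_mul]; exact zero_mem _
    · by_cases h : src α = j
      · exact Submodule.subset_span ⟨i, _, hb.cons α h rfl⟩
      · rw [← idem_mul hε hb, ← hε.right α, mul_assoc, ← mul_assoc (ε _), hε.orth _ _ h, zero_mul,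
          mul_zero]; exact zero_mem _
  | algebraMap r =>
    intro y hy
    rw [← Algebra.smul_def]
    exact Submodule.smul_mem _ _ hy
  | add x y _ _ hx hy => intro z hz; rw [add_mul]; exact add_mem (hx z hz) (hy z hz)
  | mul x y _ _ hx hy => intro z hz; rw [mul_assoc]; exact hx _ (hy z hz)

lemma corner_mem_span (hε : IsFamily src tgt ε a) {x : B}
    (hx : x ∈ Algebra.adjoin k (Set.range ε ∪ Set.range a)) (i j : V) :
    ε j * x * ε i ∈ Submodule.span k {b | PathElt src tgt ε a i j b} := by
  refine (Submodule.span_le.2 ?_ : Submodule.span k {b | ∃ i j, PathElt src tgt ε a i j b} ≤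
    (Submodule.span k {b | PathElt src tgt ε a i j b}).comap
      (LinearMap.mulRight k (ε i) ∘ₗ LinearMap.mulLeft k (ε j))) (mem_span hε hx)
  rintro b ⟨i', j', h⟩
  change ε j * b * ε i ∈ Submodule.span k {b | PathElt src tgt ε a i j b}
  by_cases hj : j = j'
  · by_cases hi : i' = i
    · subst hi hj
      rw [idem_mul hε h, mul_idem hε h]
      exact Submodule.subset_span h
    · rw [← mul_idem hε h, mul_assoc, mul_assoc, hε.orth _ _ hi, mul_zero, mul_zero]
      exact zero_mem _
  · rw [← idem_mul hε h, ← mul_assoc, hε.orth _ _ hj, zero_mul, zero_mul]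
    exact zero_mem _

lemma eq_zero_of_corner (hε : IsFamily src tgt ε a) {x : B} (h : ∀ i j, ε j * x * ε i = 0) : x = 0 := by
  rw [← one_mul x, ← mul_one (1 * x), ← hε.sum, Finset.sum_mul, Finset.sum_mul]
  refine Finset.sum_eq_zero fun j _ => ?_
  rw [Finset.mul_sum]
  exact Finset.sum_eq_zero fun i _ => h i j

end

end PathElt

namespace IsLabel

variable {k A V E : Type} [Field k] [Ring A] [Algebra k A] [Fintype V] [Fintype E]
  {P : QuiverPresentation k A V E} {n : ℕ} {v : Fin n ≃ V} {p : Fin n → ℕ}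

lemma adj_symm (hL : IsLabel P n v p) (α : E) :
    finAdj n (v.symm (P.src α)) (v.symm (P.tgt α)) ∧
      p (v.symm (P.src α)) = p (v.symm (P.tgt α)) + 1 := by
  obtain ⟨i, l, h1, h2, h3⟩ := hL.arr α
  rwa [h1, h2, Equiv.symm_apply_apply, Equiv.symm_apply_apply]

section

variable {B : Type} [Mul B] {ε : V → B} {a : E → B}

lemma height_le (hL : IsLabel P n v p) {i j : V} {b : B} (h : PathElt P.src P.tgt ε a i j b) :
    p (v.symm j) ≤ p (v.symm i) := by
  induction h with
  | nil => exact le_rfl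
  | cons h α hs ht ih =>
    subst hs ht
    have := (hL.adj_symm α).2
    omega

/-- The connected component of `x` in the complement of the vertex `l` of `D_n`. -/
def branch (l x : ℕ) : ℕ := if l < 2 then 0 else if l < x then 2 else if l = 2 then x else 0

lemma branch_eq (hL : IsLabel P n v p) {i j : V} {b : B} (h : PathElt P.src P.tgt ε a i j b)
    {l : Fin n} (hl : p l < p (v.symm j)) : branch l (v.symm i) = branch l (v.symm j) := by
  induction h with
  | nil => rfl
  | cons h α hs ht ih =>
    subst hs ht
    obtain ⟨h1, h2⟩ := hL.adj_symm α
    rw [ih (by omega)]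
    have hx : (l : ℕ) ≠ v.symm (P.src α) := fun h => by rw [Fin.ext h] at hl; omega
    have hy : (l : ℕ) ≠ v.symm (P.tgt α) := fun h => by rw [Fin.ext h] at hl; omega
    unfold finAdj Preproj.DAdj at h1
    unfold branch
    split_ifs <;> omega

lemma pathElt_unique (hL : IsLabel P n v p) {i j : V} {b b' : B}
    (h : PathElt P.src P.tgt ε a i j b) (h' : PathElt P.src P.tgt ε a i j b') : b = b' := by
  induction h generalizing b' with
  | nil =>
    cases h' with
    | nil => rfl
    | cons h' α hs ht =>
      subst hs ht
      have := hL.height_le h'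
      have := (hL.adj_symm α).2
      omega
  | cons h α hs ht ih =>
    subst hs ht
    cases h' with
    | nil =>
      have := hL.height_le h
      have := (hL.adj_symm α).2
      omega
    | cons h' β hs ht =>
      subst hs
      obtain ⟨h1, h2⟩ := hL.adj_symm α
      obtain ⟨h3, h4⟩ := hL.adj_symm β
      rw [ht] at h3 h4
      have hb := (hL.branch_eq h (l := v.symm (P.tgt α)) (by omega)).symm.trans
        (hL.branch_eq h' (by omega))
      have hs : v.symm (P.src α) = v.symm (P.src β) := by
        apply Fin.ext
        unfold finAdj Preproj.DAdj at h1 h3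
        unfold branch at hb
        split_ifs at hb <;> omega
      obtain rfl := hL.uniq α β (v.symm.injective hs) ht.symm
      rw [ih h']

end

end IsLabel

namespace QuiverPresentation

variable {k A V E : Type} [Field k] [Ring A] [Algebra k A] [Fintype V] [Fintype E]
  (P : QuiverPresentation k A V E)

lemma isFamily : PathElt.IsFamily P.src P.tgt P.idem P.arrow where
  idem := P.idem_idem
  orth := P.idem_orth
  sum := P.sum_idem
  left α := by rw [← P.arrow_mem α, ← mul_assoc, ← mul_assoc, P.idem_idem]
  right α := by rw [← P.arrow_mem α, mul_assoc, P.idem_idem]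

lemma mul_idem_eq_zero_of_mul_arrow (hher : Hereditary A) (α : E) {x : A}
    (hx : x * P.arrow α = 0) : x * P.idem (P.tgt α) = 0 := by
  set I := LinearMap.range (LinearMap.toSpanSingleton A A (P.arrow α)) with hI
  have := hher I
  obtain ⟨s, hs⟩ := Module.projective_lifting_property
    (LinearMap.toSpanSingleton A A (P.arrow α)).rangeRestrict (LinearMap.id : I →ₗ[A] I)
    (LinearMap.surjective_rangeRestrict _)
  let α' : I := ⟨P.arrow α, 1, one_smul A _⟩
  have hsm : ∀ (z : A), s (z • α') = z * s α' := fun z => map_smul s z α'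
  set e := P.idem (P.tgt α) with he
  set y := s α' with hy
  have hyα : y * P.arrow α = P.arrow α := congrArg Subtype.val (LinearMap.congr_fun hs α')
  have heα : e * P.arrow α = P.arrow α := P.isFamily.left α
  have hee : e * e = e := P.idem_idem _
  have hz : ∀ z, z * P.arrow α = P.arrow α → z * y = y := fun z h => by
    rw [← hsm, show z • α' = α' from Subtype.ext h]
  have hey := hz e heα
  have hyy := hz y hyα
  have h1 : y * e * (y * e) = y * e := by
    rw [mul_assoc, ← mul_assoc e, hey, ← mul_assoc, hyy]
  have h2 : y * e * (e - y * e) = 0 := by rw [mul_sub, h1, mul_assoc, hee, sub_self]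
  have h3 : (e - y * e) * (y * e) = 0 := by
    rw [sub_mul, h1, ← mul_assoc, hey, sub_self]
  have h4 : (e - y * e) * (e - y * e) = e - y * e := by
    rw [mul_sub, h3, sub_zero, sub_mul, hee, mul_assoc, hee]
  rcases P.idem_primitive _ _ _ h1 h4 h2 h3 (by rw [add_sub_cancel]) with h | h
  · refine absurd ?_ (P.arrow_ne α)
    rw [← hyα, ← heα, ← mul_assoc, h, zero_mul]
  · rw [sub_eq_zero.1 h, ← mul_assoc, ← hsm, show x • α' = 0 from Subtype.ext hx, map_zero,
      zero_mul]

lemma mul_idem_eq_zero (hher : Hereditary A) {i j : V} {b : A}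
    (h : PathElt P.src P.tgt P.idem P.arrow i j b) {x : A} (hx : x * b = 0) :
    x * P.idem j = 0 := by
  induction h generalizing x with
  | nil => exact hx
  | cons h α hs ht ih =>
    subst hs ht
    refine P.mul_idem_eq_zero_of_mul_arrow hher α ?_
    rw [← P.isFamily.right α, ← mul_assoc]
    exact ih (by rw [mul_assoc, hx])

lemma pathElt_ne_zero (hher : Hereditary A) {i j : V} {b : A}
    (h : PathElt P.src P.tgt P.idem P.arrow i j b) : b ≠ 0 := fun hb =>
  P.idem_ne j (by simpa using P.mul_idem_eq_zero hher h (x := 1) (by rw [hb, mul_zero]))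

end QuiverPresentation

/-- A hereditary algebra of type `D_n` has the universal property of the path algebra. -/
theorem IsLabel.exists_algHom {k A V E : Type} [Field k] [Ring A] [Algebra k A] [Fintype V]
    [Fintype E] {P : QuiverPresentation k A V E} {n : ℕ} {v : Fin n ≃ V} {p : Fin n → ℕ}
    (hL : IsLabel P n v p) (hher : Hereditary A) {B : Type} [Ring B] [Algebra k B] {ε : V → B}
    {a : E → B} (hε : PathElt.IsFamily P.src P.tgt ε a) :
    ∃ ρ : A →ₐ[k] B, (∀ i, ρ (P.idem i) = ε i) ∧ ∀ α, ρ (P.arrow α) = a α := by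
  let ε' : V → A × B := fun i => (P.idem i, ε i)
  let a' : E → A × B := fun α => (P.arrow α, a α)
  have hε' : PathElt.IsFamily P.src P.tgt ε' a' :=
    { idem := fun i => Prod.ext (P.idem_idem i) (hε.idem i)
      orth := fun i j h => Prod.ext (P.idem_orth i j h) (hε.orth i j h)
      sum := Prod.ext (by rw [Prod.fst_sum]; exact P.sum_idem)
        (by rw [Prod.snd_sum]; exact hε.sum)
      left := fun α => Prod.ext (P.isFamily.left α) (hε.left α)
      right := fun α => Prod.ext (P.isFamily.right α) (hε.right α) }
  let Γ : Subalgebra k (A × B) := Algebra.adjoin k (Set.range ε' ∪ Set.range a')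
  let f : Γ →ₐ[k] A := (AlgHom.fst k A B).comp Γ.val
  have hinj : Function.Injective f := by
    rw [injective_iff_map_eq_zero]
    rintro ⟨x, hx⟩ (h0 : x.1 = 0)
    refine Subtype.ext (PathElt.eq_zero_of_corner hε' fun i j => ?_)
    have h1 := PathElt.corner_mem_span hε' hx i j
    have h2 : (ε' j * x * ε' i).1 = 0 := by
      change P.idem j * x.1 * P.idem i = 0
      rw [h0, mul_zero, zero_mul]
    by_cases hb : ∃ b, PathElt P.src P.tgt ε' a' i j b
    · obtain ⟨b, hb⟩ := hb
      have h3 : {b | PathElt P.src P.tgt ε' a' i j b} = {b} :=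
        Set.eq_singleton_iff_unique_mem.2 ⟨hb, fun b' hb' => hL.pathElt_unique hb' hb⟩
      rw [h3] at h1
      obtain ⟨c, hc⟩ := Submodule.mem_span_singleton.1 h1
      rw [← hc] at h2 ⊢
      have h4 : b.1 ≠ 0 := P.pathElt_ne_zero hher (hb.map (RingHom.fst A B))
      rcases smul_eq_zero.1 (h2 : c • b.1 = 0) with h | h
      · rw [h, zero_smul]
      · exact absurd h h4
    · rw [Set.eq_empty_of_forall_notMem (s := {b | PathElt P.src P.tgt ε' a' i j b})
        (fun b h => hb ⟨b, h⟩), Submodule.span_empty] at h1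
      exact h1
  have hεm : ∀ i, ε' i ∈ Γ := fun i => Algebra.subset_adjoin (.inl ⟨i, rfl⟩)
  have ham : ∀ α, a' α ∈ Γ := fun α => Algebra.subset_adjoin (.inr ⟨α, rfl⟩)
  have hsurj : Function.Surjective f := by
    rw [← AlgHom.range_eq_top, ← top_le_iff, ← P.generates, Algebra.adjoin_le_iff]
    rintro _ (⟨i, rfl⟩ | ⟨α, rfl⟩)
    · exact ⟨⟨ε' i, hεm i⟩, rfl⟩
    · exact ⟨⟨a' α, ham α⟩, rfl⟩
  let F := AlgEquiv.ofBijective f ⟨hinj, hsurj⟩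
  refine ⟨((AlgHom.snd k A B).comp Γ.val).comp F.symm.toAlgHom, fun i => ?_, fun α => ?_⟩
  · have : F.symm (P.idem i) = ⟨ε' i, hεm i⟩ := by rw [AlgEquiv.symm_apply_eq]; rfl
    change ((F.symm (P.idem i) : Γ) : A × B).2 = _
    rw [this]
  · have : F.symm (P.arrow α) = ⟨a' α, ham α⟩ := by rw [AlgEquiv.symm_apply_eq]; rfl
    change ((F.symm (P.arrow α) : Γ) : A × B).2 = _
    rw [this]

namespace QRep

variable {k : Type} [Field k] {I : Type} {adj : I → I → Prop} {p : I → ℕ} [Fintype I]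

lemma finite_H (X : QRep k adj p) [∀ i, Module.Finite k (X.c i)] (t : ℕ) :
    ∀ i, Module.Finite k (X.H t i) := by
  induction t with
  | zero =>
    intro i
    by_cases h : p i = 0
    · rw [X.H_self h]; infer_instance
    · rw [X.H_bot (.inl (Nat.pos_of_ne_zero h))]; infer_instance
  | succ t ih =>
    intro i
    rcases X.H_cases (t + 1) i with h | ⟨s, h1, h2, h3⟩ | h
    · rw [X.H_self h]; infer_instance
    · obtain rfl : t = s := by omega
      rw [X.H_reflect h2 h3]
      have hm : ∀ l, ∀ ξ ∈ reflect adj (X.H t) i, S (k := k) X.M l ξ ∈ X.H t l := fun l ξ hξ => by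
        by_cases hl : adj i l
        · exact hξ.2.1 l hl
        · rw [hξ.2.2.1 l hl]; exact zero_mem _
      refine Module.Finite.of_injective
        (LinearMap.pi fun l => (S (k := k) X.M l).restrict (hm l)) ?_
      rw [← LinearMap.ker_eq_bot, LinearMap.ker_eq_bot']
      intro ξ hξ
      refine Subtype.ext (funext fun γ => ?_)
      cases γ with
      | nil => exact ξ.2.1
      | cons l γ =>
        exact congrFun (congrArg Subtype.val (congrFun hξ l)) γ
    · rw [h]; infer_instance

end QRep

namespace IsLabel

variable {k A V E : Type} [Field k] [Ring A] [Algebra k A] [Fintype V] [Fintype E]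
  {P : QuiverPresentation k A V E} {n : ℕ} {v : Fin n ≃ V} {p q : Fin n → ℕ}

/-- The total space of the slice of heights `q` of the translation quiver at `X`. -/
abbrev Slice (X : QRep k (finAdj n) p) (q : Fin n → ℕ) : Type := ∀ j, X.H (q j) j

/-- The inclusion of a component of the slice. -/
noncomputable def inj (X : QRep k (finAdj n) p) (q : Fin n → ℕ) (j : Fin n) :
    X.H (q j) j →ₗ[k] Slice X q :=
  LinearMap.single k (fun j => X.H (q j) j) j

lemma inj_same (X : QRep k (finAdj n) p) (j : Fin n) (ξ : X.H (q j) j) : inj X q j ξ j = ξ :=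
  Pi.single_eq_same (M := fun j => X.H (q j) j) j ξ

lemma inj_ne (X : QRep k (finAdj n) p) {i j : Fin n} (h : i ≠ j) (ξ : X.H (q j) j) :
    inj X q j ξ i = 0 :=
  Pi.single_eq_of_ne (M := fun j => X.H (q j) j) h ξ

/-- The projection on a component of the slice. -/
noncomputable def comp (X : QRep k (finAdj n) p) (q : Fin n → ℕ) (j : Fin n) :
    Module.End k (Slice X q) :=
  inj X q j ∘ₗ LinearMap.proj j

lemma comp_apply (X : QRep k (finAdj n) p) (j : Fin n) (w : Slice X q) :
    comp X q j w = inj X q j (w j) := rfl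

/-- The action of an arrow on the slice. -/
noncomputable def arr' (hL : IsLabel P n v q) (X : QRep k (finAdj n) p) (α : E) :
    Module.End k (Slice X q) :=
  inj X q (v.symm (P.tgt α)) ∘ₗ
    (QRep.S (k := k) X.M (v.symm (P.tgt α))).restrict (fun ξ hξ => by
      rw [(hL.adj_symm α).2] at hξ
      exact QRep.S_mem (hL.adj_symm α).1 hξ) ∘ₗ LinearMap.proj (v.symm (P.src α))

lemma arr'_apply (hL : IsLabel P n v q) (X : QRep k (finAdj n) p) (α : E) (w : Slice X q) :
    ∃ h : QRep.S (k := k) X.M (v.symm (P.tgt α)) (w (v.symm (P.src α))) ∈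
        X.H (q (v.symm (P.tgt α))) (v.symm (P.tgt α)),
      hL.arr' X α w = inj X q (v.symm (P.tgt α)) ⟨_, h⟩ :=
  ⟨_, rfl⟩

lemma arr'_val (hL : IsLabel P n v q) (X : QRep k (finAdj n) p) (α : E) (w : Slice X q) :
    (hL.arr' X α w (v.symm (P.tgt α)) : List (Fin n) → X.M) =
      QRep.S (k := k) X.M (v.symm (P.tgt α)) (w (v.symm (P.src α))) := by
  obtain ⟨h, h'⟩ := hL.arr'_apply X α w
  rw [h', inj_same]

lemma comp_inj (X : QRep k (finAdj n) p) (j : Fin n) (ξ : X.H (q j) j) :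
    comp X q j (inj X q j ξ) = inj X q j ξ := by
  rw [comp_apply, inj_same]

lemma isFamily (hL : IsLabel P n v q) (X : QRep k (finAdj n) p) :
    PathElt.IsFamily P.src P.tgt (fun i => comp X q (v.symm i)) (hL.arr' X) where
  idem i := LinearMap.ext fun _ => comp_inj X (v.symm i) _
  orth i j hij := LinearMap.ext fun w => by
    change comp X q (v.symm i) (comp X q (v.symm j) w) = 0
    rw [comp_apply, comp_apply, inj_ne X (fun h => hij (v.symm.injective h)), map_zero]
  sum := LinearMap.ext fun w => by
    rw [v.symm.sum_comp (comp X q), LinearMap.sum_apply]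
    exact Finset.univ_sum_single w
  left α := LinearMap.ext fun _ => comp_inj X _ _
  right α := LinearMap.ext fun w => by
    change hL.arr' X α (comp X q (v.symm (P.src α)) w) = hL.arr' X α w
    obtain ⟨h1, h2⟩ := hL.arr'_apply X α w
    obtain ⟨h3, h4⟩ := hL.arr'_apply X α (comp X q (v.symm (P.src α)) w)
    rw [h2, h4]
    congr 2
    rw [comp_apply, inj_same]

/-- The action of the algebra on the slice. -/
noncomputable def rho (hL : IsLabel P n v q) (hher : Hereditary A) (X : QRep k (finAdj n) p) :
    A →ₐ[k] Module.End k (Slice X q) :=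
  (hL.exists_algHom hher (hL.isFamily X)).choose

lemma rho_idem (hL : IsLabel P n v q) (hher : Hereditary A) (X : QRep k (finAdj n) p)
    (j : Fin n) : hL.rho hher X (P.idem (v j)) = comp X q j := by
  rw [rho, (hL.exists_algHom hher (hL.isFamily X)).choose_spec.1, Equiv.symm_apply_apply]

lemma rho_arrow (hL : IsLabel P n v q) (hher : Hereditary A) (X : QRep k (finAdj n) p) (α : E) :
    hL.rho hher X (P.arrow α) = hL.arr' X α :=
  (hL.exists_algHom hher (hL.isFamily X)).choose_spec.2 α

/-- The module structure on the slice. -/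
@[reducible] noncomputable def sliceModule (hL : IsLabel P n v q) (hher : Hereditary A)
    (X : QRep k (finAdj n) p) : Module A (Slice X q) :=
  Module.compHom _ (hL.rho hher X).toRingHom

/-- The slice as a module over the algebra. -/
noncomputable def slice (hL : IsLabel P n v q) (hher : Hereditary A)
    (X : QRep k (finAdj n) p) : ModuleCat.{0} A :=
  letI := hL.sliceModule hher X
  ModuleCat.of A (Slice X q)

lemma finite_slice (hL : IsLabel P n v q) (hher : Hereditary A) (X : QRep k (finAdj n) p)
    [∀ i, Module.Finite k (X.c i)] : Module.Finite A (hL.slice hher X) := by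
  let _ := hL.sliceModule hher X
  have : IsScalarTower k A (Slice X q) := ⟨fun c a w => by
    change hL.rho hher X (c • a) w = c • hL.rho hher X a w
    rw [map_smul]; rfl⟩
  have : ∀ i, Module.Finite k (X.H (q i) i) := fun i => X.finite_H _ i
  exact Module.Finite.of_restrictScalars_finite k A (Slice X q)

lemma rho_comm (hL : IsLabel P n v q) (hher : Hereditary A) {X Y : QRep k (finAdj n) p}
    (f : Slice X q →ₗ[k] Slice Y q) (h1 : ∀ j w, f (comp X q j w) = comp Y q j (f w))
    (h2 : ∀ α w, f (hL.arr' X α w) = hL.arr' Y α (f w)) (a : A) (w : Slice X q) :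
    f (hL.rho hher X a w) = hL.rho hher Y a (f w) := by
  have ha : a ∈ Algebra.adjoin k (Set.range P.idem ∪ Set.range P.arrow) := by
    rw [P.generates]; trivial
  induction ha using Algebra.adjoin_induction generalizing w with
  | mem a ha =>
    rcases ha with ⟨j, rfl⟩ | ⟨α, rfl⟩
    · obtain ⟨j, rfl⟩ := v.surjective j
      rw [rho_idem, rho_idem, h1]
    · rw [rho_arrow, rho_arrow, h2]
  | algebraMap r =>
    rw [AlgHom.commutes, AlgHom.commutes, Module.algebraMap_end_apply,
      Module.algebraMap_end_apply, map_smul]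
  | add a b _ _ ha hb =>
    rw [map_add, map_add, LinearMap.add_apply, LinearMap.add_apply, map_add, ha, hb]
  | mul a b _ _ ha hb =>
    rw [map_mul, map_mul, Module.End.mul_apply, Module.End.mul_apply, ha, hb]

/-- The linear map between slices induced by a morphism of representations. -/
noncomputable def sliceLin {X Y : QRep k (finAdj n) p} (q : Fin n → ℕ) {g : X.M →ₗ[k] Y.M}
    (hg : QRep.IsHom X Y g) : Slice X q →ₗ[k] Slice Y q :=
  LinearMap.pi fun j => (g.compLeft (List (Fin n))).restrict
    (fun _ hξ => hg.compLeft_mem _ hξ) ∘ₗ LinearMap.proj j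

lemma sliceLin_inj {X Y : QRep k (finAdj n) p} {g : X.M →ₗ[k] Y.M}
    (hg : QRep.IsHom X Y g) (j : Fin n) (ξ : X.H (q j) j) :
    sliceLin q hg (inj X q j ξ) =
      inj Y q j ⟨g.compLeft (List (Fin n)) ξ, hg.compLeft_mem _ ξ.2⟩ := by
  ext1 i
  change (g.compLeft (List (Fin n))).restrict (fun _ hξ => hg.compLeft_mem _ hξ)
    (inj X q j ξ i) = _
  by_cases h : i = j
  · subst h
    rw [inj_same, inj_same]
    rfl
  · rw [inj_ne X h, inj_ne Y h, map_zero]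

/-- The homomorphism of modules induced by a morphism of representations. -/
noncomputable def sliceMap (hL : IsLabel P n v q) (hher : Hereditary A)
    {X Y : QRep k (finAdj n) p} {g : X.M →ₗ[k] Y.M} (hg : QRep.IsHom X Y g) :
    hL.slice hher X ⟶ hL.slice hher Y :=
  letI := hL.sliceModule hher X
  letI := hL.sliceModule hher Y
  ModuleCat.ofHom
    { toFun := sliceLin q hg
      map_add' := map_add _
      map_smul' := hL.rho_comm hher (sliceLin q hg)
        (fun j _ => sliceLin_inj hg j _) (fun _ _ => sliceLin_inj hg _ _) }

/-- Homomorphisms between slices come from morphisms of representations. -/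
theorem slice_hom_eq_zero (hL : IsLabel P n v q) (hher : Hereditary A)
    {X Y : QRep k (finAdj n) p} (hp : IsHeight (finAdj n) p) (hpq : ∀ i, p i ≤ q i)
    (hpar : ∀ i, q i % 2 = p i % 2)
    (h0 : ∀ g : Y.M →ₗ[k] X.M, QRep.IsHom Y X g → ∀ j, ∀ x ∈ Y.c j, g x = 0)
    (F : hL.slice hher Y ⟶ hL.slice hher X) : F = 0 := by
  let _ := hL.sliceModule hher X
  let _ := hL.sliceModule hher Y
  let F₀ : Slice Y q →ₗ[A] Slice X q := F.hom
  have hF : ∀ (a : A) w, F₀ (hL.rho hher Y a w) = hL.rho hher X a (F₀ w) :=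
    fun a w => map_smul F₀ a w
  let f : Slice Y q →ₗ[k] Slice X q :=
    { toFun := F₀
      map_add' := map_add F₀
      map_smul' := fun c w => by
        have := hF (algebraMap k A c) w
        rwa [AlgHom.commutes, AlgHom.commutes, Module.algebraMap_end_apply,
          Module.algebraMap_end_apply] at this }
  have h1 : ∀ j w, f (comp Y q j w) = comp X q j (f w) := fun j w => by
    rw [← hL.rho_idem hher, ← hL.rho_idem hher]; exact hF _ w
  have h2 : ∀ α w, f (hL.arr' Y α w) = hL.arr' X α (f w) := fun α w => by
    rw [← hL.rho_arrow hher, ← hL.rho_arrow hher]; exact hF _ w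
  let G₀ : ∀ j, Y.H (q j) j →ₗ[k] X.H (q j) j := fun j =>
    LinearMap.proj j ∘ₗ f ∘ₗ inj Y q j
  have hG₀ : ∀ j w, f w j = G₀ j (w j) := fun j w => by
    rw [← inj_same X j (f w j), ← comp_apply, ← h1]
    rfl
  choose G hG using fun j => LinearMap.exists_extend ((X.H (q j) j).subtype ∘ₗ G₀ j)
  have hGa : ∀ j (ξ : Y.H (q j) j), G j ξ = G₀ j ξ := fun j ξ => LinearMap.congr_fun (hG j) ξ
  obtain ⟨g, hg, hgG⟩ := QRep.full hp _ q rfl hL.height hpq hpar G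
    (fun i ξ hξ => by rw [hGa i ⟨ξ, hξ⟩]; exact Subtype.prop _) (by
      intro i l hil hq ξ hξ
      obtain ⟨α, hs, ht⟩ := hL.ex i l hil hq
      obtain rfl : v.symm (P.src α) = i := by rw [hs, Equiv.symm_apply_apply]
      obtain rfl : v.symm (P.tgt α) = l := by rw [ht, Equiv.symm_apply_apply]
      set i := v.symm (P.src α)
      set l := v.symm (P.tgt α)
      set w := inj Y q i ⟨ξ, hξ⟩ with hw
      have hwi : w i = ⟨ξ, hξ⟩ := inj_same Y i _
      have h3 : G i ξ = f w i := by rw [hG₀, ← hGa, hwi]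
      have h4 : (hL.arr' Y α w l : List (Fin n) → Y.M) = QRep.S (k := k) Y.M l ξ := by
        rw [hL.arr'_val, hwi]
      rw [← h4, hGa, ← hG₀, h2, hL.arr'_val, h3])
  have hz : ∀ w, f w = 0 := fun w => by
    refine funext fun j => Subtype.ext (funext fun γ => ?_)
    rw [hG₀, ← hGa, hgG j _ (w j).2]
    obtain ⟨l, hl⟩ := Y.apply_mem γ (w j).2
    exact h0 g hg l _ hl
  ext w
  exact hz w

end IsLabel

namespace QRep

section Thin

variable {k : Type} [Field k] {n : ℕ} {p : Fin n → ℕ}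

/-- The inclusion of the component at a vertex. -/
noncomputable def ι (k : Type) [Field k] {n : ℕ} (j : Fin n) : k × k →ₗ[k] (Fin n → k × k) :=
  LinearMap.single k (fun _ => k × k) j

lemma ι_same (j : Fin n) (x : k × k) : ι k j x j = x := Pi.single_eq_same (M := fun _ => k × k) j x

lemma ι_ne {i j : Fin n} (h : i ≠ j) (x : k × k) : ι k j x i = 0 :=
  Pi.single_eq_of_ne (M := fun _ => k × k) h x

/-- The representation with components the ranges of the given operators on the plane, in which
every arrow acts by the operator at its target. -/
noncomputable abbrev ofOps (p : Fin n → ℕ) (F : Fin n → k × k →ₗ[k] k × k) :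
    QRep k (finAdj n) p where
  M := Fin n → k × k
  c j := (LinearMap.range (F j)).map (ι k j)
  φ i l := if finAdj n i l ∧ p i = p l + 1 then ι k l ∘ₗ F l ∘ₗ LinearMap.proj i else 0
  e j := ι k j ∘ₗ LinearMap.proj j
  e_self := by
    rintro j _ ⟨x, -, rfl⟩
    change ι k j (ι k j x j) = _
    rw [ι_same]
  e_ne := by
    rintro i j _ h ⟨x, -, rfl⟩
    change ι k j (ι k i x j) = _
    rw [ι_ne h.symm, map_zero]
  φ_mem {i x} l _ := by
    split_ifs
    · exact ⟨_, ⟨x i, rfl⟩, rfl⟩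
    · exact zero_mem _
  φ_zero {i l x} h _ := by rw [if_neg h, LinearMap.zero_apply]

variable {F F' : Fin n → k × k →ₗ[k] k × k}

lemma ofOps_φ {i l : Fin n} (h : finAdj n i l ∧ p i = p l + 1) (x : Fin n → k × k) :
    (ofOps p F).φ i l x = ι k l (F l (x i)) := by
  change (if finAdj n i l ∧ p i = p l + 1 then ι k l ∘ₗ F l ∘ₗ LinearMap.proj i else 0) x = _
  rw [if_pos h]; rfl

/-- The maps acting on each component by the operators of the target. -/
noncomputable def opsMap (F' : Fin n → k × k →ₗ[k] k × k) :
    (Fin n → k × k) →ₗ[k] (Fin n → k × k) :=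
  LinearMap.pi fun j => F' j ∘ₗ LinearMap.proj j

lemma opsMap_ι (j : Fin n) (x : k × k) : opsMap F' (ι k j x) = ι k j (F' j x) := by
  ext1 i
  change F' i (ι k j x i) = _
  by_cases h : i = j
  · subst h; rw [ι_same, ι_same]
  · rw [ι_ne h, ι_ne h, map_zero]

lemma isHom_opsMap (h : ∀ i l, finAdj n i l → p i = p l + 1 → ∀ x,
    F' l (F l (F i x)) = F' l (F' i (F i x))) : IsHom (ofOps p F) (ofOps p F') (opsMap F') where
  mem := by
    rintro i _ ⟨x, -, rfl⟩
    rw [opsMap_ι]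
    exact ⟨_, ⟨x, rfl⟩, rfl⟩
  comm := by
    rintro i l _ ⟨_, ⟨x, rfl⟩, rfl⟩
    by_cases hil : finAdj n i l ∧ p i = p l + 1
    · rw [ofOps_φ hil, ofOps_φ hil, opsMap_ι, opsMap_ι, ι_same, ι_same, h i l hil.1 hil.2]
    · rw [(ofOps p F).φ_zero hil ⟨_, ⟨x, rfl⟩, rfl⟩, map_zero, opsMap_ι,
        (ofOps p F').φ_zero hil ⟨_, ⟨_, rfl⟩, rfl⟩]

lemma ofOps_hom_eq_zero (h : ∀ γ : Fin n → k × k →ₗ[k] k × k,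
      (∀ j x, ∃ y, γ j (F j x) = F' j y) →
      (∀ i l, finAdj n i l → p i = p l + 1 → ∀ x, γ l (F l (F i x)) = F' l (γ i (F i x))) →
      ∀ j x, γ j (F j x) = 0)
    {g : (Fin n → k × k) →ₗ[k] (Fin n → k × k)} (hg : IsHom (ofOps p F) (ofOps p F') g) {j : Fin n}
    {x : Fin n → k × k} (hx : x ∈ (ofOps p F).c j) : g x = 0 := by
  have hmem : ∀ j x, ∃ y, g (ι k j (F j x)) = ι k j (F' j y) := by
    intro j x
    obtain ⟨_, ⟨y, rfl⟩, hy⟩ := hg.mem (i := j) ⟨F j x, ⟨x, rfl⟩, rfl⟩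
    exact ⟨y, hy.symm⟩
  have hγ : ∀ j x, g (ι k j (F j x)) = ι k j (g (ι k j (F j x)) j) := by
    intro j x
    obtain ⟨y, hy⟩ := hmem j x
    rw [hy, ι_same]
  obtain ⟨_, ⟨x, rfl⟩, rfl⟩ := hx
  rw [hγ]
  refine (congrArg (ι k j) (h (fun j => LinearMap.proj j ∘ₗ g ∘ₗ ι k j) ?_ ?_ j x)).trans (map_zero (ι k j))
  · intro j x
    obtain ⟨y, hy⟩ := hmem j x
    refine ⟨y, ?_⟩
    change g (ι k j (F j x)) j = _
    rw [hy, ι_same]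
  · intro i l hil hp x
    have h1 := hg.comm (i := i) (l := l) (x := ι k i (F i x)) ⟨_, ⟨x, rfl⟩, rfl⟩
    rw [ofOps_φ ⟨hil, hp⟩, ofOps_φ ⟨hil, hp⟩, ι_same] at h1
    have h2 := congrFun h1 l
    rwa [ι_same] at h2

end Thin

/-- Some idempotent operators on the plane. -/
def op (k : Type) [Field k] : ℕ → k × k →ₗ[k] k × k
  | 0 => 0
  | 1 => (LinearMap.fst k k k).prod 0
  | 2 => (0 : k × k →ₗ[k] k).prod (LinearMap.snd k k k)
  | 3 => (LinearMap.fst k k k).prod (LinearMap.fst k k k)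
  | _ => LinearMap.id

/-- The operators defining a chain of representations of `D_n` with a single source at the end of
the long arm. -/
def code (n s j : ℕ) : ℕ :=
  if s + 3 ≤ n then (if j = 0 then 1 else if j = 1 then 2 else if j ≤ s + 1 then 4 else 3)
  else if s + 2 = n then (if j = 1 then 0 else 1)
  else if s + 3 ≤ n + j then 1 else 0

lemma code_spec (n s j : ℕ) :
    (s + 3 ≤ n ∧ j = 0 ∧ code n s j = 1) ∨ (s + 3 ≤ n ∧ j = 1 ∧ code n s j = 2) ∨
    (s + 3 ≤ n ∧ 2 ≤ j ∧ j ≤ s + 1 ∧ code n s j = 4) ∨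
    (s + 3 ≤ n ∧ 2 ≤ j ∧ s + 2 ≤ j ∧ code n s j = 3) ∨
    (s + 2 = n ∧ j = 1 ∧ code n s j = 0) ∨ (s + 2 = n ∧ j ≠ 1 ∧ code n s j = 1) ∨
    (n < s + 2 ∧ s + 3 ≤ n + j ∧ code n s j = 1) ∨ (n < s + 2 ∧ n + j < s + 3 ∧ code n s j = 0) := by
  unfold code
  split_ifs <;> omega

section

variable {k : Type} [Field k]

@[simp] lemma op_zero (x : k × k) : op k 0 x = 0 := rfl
@[simp] lemma op_one (x : k × k) : op k 1 x = (x.1, 0) := rfl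
@[simp] lemma op_two (x : k × k) : op k 2 x = (0, x.2) := rfl
@[simp] lemma op_three (x : k × k) : op k 3 x = (x.1, x.1) := rfl
@[simp] lemma op_four (x : k × k) : op k 4 x = x := rfl

lemma op_comm (n s i l : ℕ) (hi : i < n) (h : (i = 2 ∧ l < 2) ∨ (2 ≤ l ∧ i = l + 1)) (x : k × k) :
    op k (code n (s + 1) l) (op k (code n s l) (op k (code n s i) x)) =
      op k (code n (s + 1) l) (op k (code n (s + 1) i) (op k (code n s i) x)) := by
  unfold code
  split_ifs <;> first | omega | simp

lemma op_hom_eq_zero (n s : ℕ) (hn : 4 ≤ n) (γ : ℕ → k × k →ₗ[k] k × k)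
    (hγ : ∀ j < n, ∀ x, ∃ y, γ j (op k (code n (s + 1) j) x) = op k (code n s j) y)
    (hc : ∀ i l, i < n → (i = 2 ∧ l < 2) ∨ (2 ≤ l ∧ i = l + 1) → ∀ x,
      γ l (op k (code n (s + 1) l) (op k (code n (s + 1) i) x)) =
        op k (code n s l) (γ i (op k (code n (s + 1) i) x))) :
    ∀ j < n, ∀ x, γ j (op k (code n (s + 1) j) x) = 0 := by
  have diag : s + 3 ≤ n → ∀ x, ∀ j, 2 ≤ j → j ≤ s + 2 →
      γ j (op k (code n (s + 1) 2) x) = γ 2 (op k (code n (s + 1) 2) x) := by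
    intro h3 x j hj hjs
    induction j, hj using Nat.le_induction with
    | base => rfl
    | succ j hj ih =>
      rw [← ih (by omega)]
      have h := hc (j + 1) j (by omega) (.inr ⟨hj, rfl⟩) x
      rw [show code n s j = 4 by have := code_spec n s j; omega, op_four] at h
      have e1 : code n (s + 1) (j + 1) = code n (s + 1) 2 := by
        have := code_spec n (s + 1) (j + 1); have := code_spec n (s + 1) 2; omega
      have e2 : code n (s + 1) j = code n (s + 1) 2 := by
        have := code_spec n (s + 1) j; have := code_spec n (s + 1) 2; omega
      rw [e1, e2] at h
      rw [← h]
      congr 1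
      unfold code
      split_ifs <;> first | omega | simp
  have diag' : s + 3 ≤ n → ∀ x, ∃ a, γ 2 (op k (code n (s + 1) 2) x) = (a, a) := by
    intro h3 x
    rw [← diag h3 x (s + 2) (by omega) le_rfl]
    obtain ⟨y, hy⟩ := hγ (s + 2) (by omega) x
    rw [show code n (s + 1) (s + 2) = code n (s + 1) 2 by
        have := code_spec n (s + 1) (s + 2); have := code_spec n (s + 1) 2; omega,
      show code n s (s + 2) = 3 by have := code_spec n s (s + 2); omega] at hy
    exact ⟨y.1, hy⟩
  have base : ∀ x, γ 2 (op k (code n (s + 1) 2) x) = 0 := by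
    intro x
    have h0 := hc 2 0 (by omega) (.inl ⟨rfl, by omega⟩)
    have h1 := hc 2 1 (by omega) (.inl ⟨rfl, by omega⟩)
    rcases lt_trichotomy (s + 3) n with h | h | h
    · have hd := diag' h.le
      rw [show code n (s + 1) 2 = 4 by have := code_spec n (s + 1) 2; omega] at h0 h1 hd ⊢
      rw [show code n (s + 1) 0 = 1 by have := code_spec n (s + 1) 0; omega,
        show code n s 0 = 1 by have := code_spec n s 0; omega] at h0
      rw [show code n (s + 1) 1 = 2 by have := code_spec n (s + 1) 1; omega,
        show code n s 1 = 2 by have := code_spec n s 1; omega] at h1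
      simp only [op_one, op_two, op_four] at h0 h1 hd ⊢
      have e : x = (x.1, 0) + (0, x.2) := by ext <;> simp
      have e1 : γ 2 (x.1, 0) = 0 := by
        obtain ⟨a, ha⟩ := hd (x.1, 0)
        have := h1 (x.1, 0)
        rw [ha] at this ⊢
        have h := (Prod.ext_iff.1 this).2
        simp only [Prod.mk_zero_zero, map_zero, Prod.snd_zero] at h
        rw [← h]; rfl
      have e2 : γ 2 (0, x.2) = 0 := by
        obtain ⟨a, ha⟩ := hd (0, x.2)
        have := h0 (0, x.2)
        rw [ha] at this ⊢
        have h := (Prod.ext_iff.1 this).1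
        simp only [Prod.mk_zero_zero, map_zero, Prod.fst_zero] at h
        rw [← h]; rfl
      rw [e, map_add, e1, e2, add_zero]
    · obtain ⟨a, ha⟩ := diag' h.le x
      have := h1 x
      rw [show code n (s + 1) 1 = 0 by have := code_spec n (s + 1) 1; omega,
        show code n s 1 = 2 by have := code_spec n s 1; omega, op_zero, map_zero, op_two, ha]
        at this
      have h := (Prod.ext_iff.1 this).2
      simp only [Prod.snd_zero] at h
      rw [ha, ← h]; rfl
    · by_cases h' : s + 2 = n
      · obtain ⟨y, hy⟩ := hγ 2 (by omega) x
        have := h0 x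
        rw [hy, show code n s 2 = 1 by have := code_spec n s 2; omega,
          show code n s 0 = 1 by have := code_spec n s 0; omega,
          show code n (s + 1) 0 = 0 by have := code_spec n (s + 1) 0; omega] at this
        rw [hy, show code n s 2 = 1 by have := code_spec n s 2; omega]
        simpa using this.symm
      · rw [show code n (s + 1) 2 = 0 by have := code_spec n (s + 1) 2; omega, op_zero, map_zero]
  have up : ∀ j, 2 ≤ j → j < n → ∀ x, γ j (op k (code n (s + 1) j) x) = 0 := by
    intro j hj
    induction j, hj using Nat.le_induction with
    | base => exact fun _ => base
    | succ l hl ih =>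
      intro hln x
      by_cases h0 : code n (s + 1) (l + 1) = 0
      · rw [h0, op_zero, map_zero]
      have h := hc (l + 1) l hln (.inr ⟨hl, rfl⟩) x
      rw [ih (by omega)] at h
      obtain ⟨y, hy⟩ := hγ (l + 1) hln x
      rw [hy] at h ⊢
      revert h h0
      unfold code
      split_ifs <;> first | omega | simp +contextual [Prod.ext_iff, eq_comm]
  intro j hj x
  by_cases h2 : 2 ≤ j
  · exact up j h2 hj x
  by_cases h3 : s + 3 ≤ n
  · have h := hc 2 j (by omega) (.inl ⟨rfl, by omega⟩)
    simp only [base, map_zero] at h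
    by_cases h0 : code n (s + 1) j = 0
    · rw [h0, op_zero, map_zero]
    rw [← h (op k (code n (s + 1) j) x)]
    congr 1
    revert h0
    unfold code
    split_ifs <;> first | contradiction | omega | simp
  · rw [show code n (s + 1) j = 0 by have := code_spec n (s + 1) j; omega, op_zero, map_zero]

end

end QRep

namespace QRep

/-- The heights of the vertices of `D_n` with the end of the long arm as single source. -/
def armHeight (n a : ℕ) (j : Fin n) : ℕ := a - if j.val < 2 then n - 2 else n - 1 - j.val

variable {n : ℕ}

lemma armHeight_spec (a : ℕ) (j : Fin n) :
    (j.val < 2 ∧ armHeight n a j = a - (n - 2)) ∨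
      (2 ≤ j.val ∧ armHeight n a j = a - (n - 1 - j.val)) := by
  unfold armHeight
  split_ifs <;> omega

lemma isHeight_armHeight {q : Fin n → ℕ} (hq : IsHeight (finAdj n) q) (hn : 4 ≤ n) {a : ℕ}
    (ha : n ≤ a) : IsHeight (finAdj n) (armHeight n a) where
  symm := hq.symm
  step {i l} h := by
    have := i.2
    have := l.2
    unfold finAdj Preproj.DAdj at h
    unfold armHeight
    split_ifs <;> omega

lemma armHeight_arrow (hn : 4 ≤ n) {a : ℕ} (ha : n ≤ a) {i l : Fin n} (h : finAdj n i l)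
    (hp : armHeight n a i = armHeight n a l + 1) :
    (i.val = 2 ∧ l.val < 2) ∨ (2 ≤ l.val ∧ i.val = l.val + 1) := by
  have := i.2
  have := l.2
  unfold finAdj Preproj.DAdj at h
  unfold armHeight at hp
  split_ifs at hp <;> omega

lemma armHeight_le {q : Fin n → ℕ} (hq : IsHeight (finAdj n) q) (hn : 4 ≤ n)
    {w : Fin n} (hw : w.val = n - 1) (ha : n ≤ q w) (j : Fin n) :
    armHeight n (q w) j ≤ q j ∧ q j % 2 = armHeight n (q w) j % 2 := by
  have arm : ∀ d (j : Fin n), 2 ≤ j.val → j.val + d = n - 1 →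
      armHeight n (q w) j ≤ q j ∧ q j % 2 = armHeight n (q w) j % 2 := by
    intro d
    induction d with
    | zero =>
      intro j h2 hj
      obtain rfl : j = w := Fin.ext (by omega)
      unfold armHeight
      split_ifs <;> omega
    | succ d ih =>
      intro j h2 hj
      have h := ih ⟨j + 1, by omega⟩ (by simp only; omega) (by simp only; omega)
      have hs := hq.step (i := j) (l := ⟨j + 1, by omega⟩)
        (show Preproj.DAdj n j (j + 1) from ⟨j.2, by omega, by omega⟩)
      have h1 := armHeight_spec (q w) j
      have h2 := armHeight_spec (n := n) (q w) ⟨j + 1, by omega⟩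
      simp only at h2
      omega
  by_cases hj : 2 ≤ j.val
  · exact arm (n - 1 - j) j hj (by omega)
  · have h := arm (n - 3) ⟨2, by omega⟩ le_rfl (by simp only; omega)
    have hs := hq.step (i := j) (l := ⟨2, by omega⟩)
      (show Preproj.DAdj n j 2 from ⟨j.2, by omega, by omega⟩)
    have h1 := armHeight_spec (q w) j
    have h2 := armHeight_spec (n := n) (q w) ⟨2, by omega⟩
    simp only at h2
    omega

variable (k : Type) [Field k]

/-- A chain of representations of `D_n` with the end of the long arm as single source. -/
noncomputable abbrev chain (p : Fin n → ℕ) (s : ℕ) : QRep k (finAdj n) p :=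
  ofOps p fun j => op k (code n s j)

instance (p : Fin n → ℕ) (s : ℕ) (i : Fin n) : Module.Finite k ((chain k p s).c i) :=
  inferInstanceAs (Module.Finite k
    ((LinearMap.range (op k (code n s i))).map (ι k i) : Submodule k (Fin n → k × k)))

/-- The map from one representation of the chain to the next one. -/
noncomputable abbrev chainMap (s : ℕ) : (Fin n → k × k) →ₗ[k] (Fin n → k × k) :=
  opsMap fun j => op k (code n (s + 1) j)

variable {k}

lemma isHom_chainMap (hn : 4 ≤ n) {a : ℕ} (ha : n ≤ a) (s : ℕ) :
    IsHom (chain k (armHeight n a) s) (chain k (armHeight n a) (s + 1)) (chainMap k s) :=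
  isHom_opsMap fun i _ hil hp => op_comm n s i _ i.2 (armHeight_arrow hn ha hil hp)

lemma chain_hom_eq_zero (hn : 4 ≤ n) {a : ℕ} (ha : n ≤ a) (s : ℕ)
    (g : (Fin n → k × k) →ₗ[k] (Fin n → k × k))
    (hg : IsHom (chain k (armHeight n a) (s + 1)) (chain k (armHeight n a) s) g) (j : Fin n)
    (x : Fin n → k × k) (hx : x ∈ (chain k (armHeight n a) (s + 1)).c j) : g x = 0 := by
  refine ofOps_hom_eq_zero (fun γ hγ hc j => ?_) hg hx
  have h := op_hom_eq_zero n s hn (fun j => if hj : j < n then γ ⟨j, hj⟩ else 0) ?_ ?_ j j.2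
  · simpa only [j.2, dif_pos] using h
  · intro j hj
    simpa only [hj, dif_pos] using hγ ⟨j, hj⟩
  · intro i l hi hil x
    have hl : l < n := by omega
    simp only [hl, hi, dif_pos]
    refine hc ⟨i, hi⟩ ⟨l, hl⟩ ?_ ?_ x
    · unfold finAdj Preproj.DAdj
      simp only
      omega
    · unfold armHeight
      simp only
      split_ifs <;> omega

/-- An element at the end of the long arm which survives along the chain. -/
noncomputable abbrev chainElt (k : Type) [Field k] {n : ℕ} (w : Fin n) (s : ℕ) : Fin n → k × k :=
  ι k w (op k (code n s w) (1, 1))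

lemma chainElt_ne_zero {w : Fin n} (hw : w.val = n - 1) (hn : 4 ≤ n) {s : ℕ}
    (hs : s + 4 ≤ 2 * n) : chainElt k w s ≠ 0 := by
  intro h
  have h : ι k w (op k (code n s w) (1, 1)) w = 0 := congrFun h w
  rw [ι_same] at h
  have h1 : code n s w = 3 ∨ code n s w = 1 := by
    have := code_spec n s w
    omega
  rcases h1 with h1 | h1 <;> simp [h1] at h

lemma chainMap_elt {w : Fin n} (hw : w.val = n - 1) (hn : 4 ≤ n) {s : ℕ}
    (hs : s + 5 ≤ 2 * n) : chainMap k s (chainElt k w s) = chainElt k w (s + 1) := by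
  refine (opsMap_ι w _).trans (congrArg (ι k w) ?_)
  have h1 : code n s w = 3 ∨ code n s w = 1 := by
    have := code_spec n s w
    omega
  have h2 : code n (s + 1) w = 3 ∧ code n s w = 3 ∨ code n (s + 1) w = 1 := by
    have := code_spec n (s + 1) w
    have := code_spec n s w
    omega
  rcases h1 with h1 | h1 <;> rcases h2 with h2 | h2 <;>
    simp_all

end QRep

namespace IsLabel

variable {k A V E : Type} [Field k] [Ring A] [Algebra k A] [Fintype V] [Fintype E]
  {P : QuiverPresentation k A V E} {n : ℕ} {v : Fin n ≃ V} {q : Fin n → ℕ}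

lemma mem_radSet_of_forall_eq_zero {X Y : ModuleCat.{0} A} (f : X ⟶ Y)
    (h : ∀ g : Y ⟶ X, g = 0) : f ∈ radSet A X Y := by
  intro M hM a b hiso
  have h1 : b ≫ a = 0 := h _
  have h2 : (a ≫ f ≫ b) ≫ (a ≫ f ≫ b) = 0 := by
    rw [show (a ≫ f ≫ b) ≫ (a ≫ f ≫ b) = a ≫ f ≫ (b ≫ a) ≫ f ≫ b by simp only [Category.assoc], h1]
    simp
  have h3 : a ≫ f ≫ b = 0 := by
    rwa [← cancel_mono (a ≫ f ≫ b), Limits.zero_comp]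
  have h4 : 𝟙 M = 0 :=
    (IsIso.hom_inv_id (a ≫ f ≫ b)).symm.trans
      ((congrArg (· ≫ inv (a ≫ f ≫ b)) h3).trans Limits.zero_comp)
  have : Nontrivial M := hM.2.1
  obtain ⟨x, hx⟩ := exists_ne (0 : M)
  exact hx (congrArg (fun g : M ⟶ M => g.hom x) h4)

/-- The element of a slice of the chain which survives along the chain. -/
noncomputable def sliceElt (k : Type) [Field k] {n : ℕ} {q : Fin n → ℕ} {w : Fin n}
    (hw : QRep.armHeight n (q w) w = q w) (s : ℕ) :
    Slice (QRep.chain k (QRep.armHeight n (q w)) s) q :=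
  inj (QRep.chain k (QRep.armHeight n (q w)) s) q w
    ⟨(QRep.chain k (QRep.armHeight n (q w)) s).lift w (QRep.chainElt k w s), by
      rw [QRep.H_self _ hw]
      exact ⟨_, ⟨_, ⟨_, rfl⟩, rfl⟩, rfl⟩⟩

lemma sliceElt_ne_zero (hn : 4 ≤ n) {w : Fin n} (hw : w.val = n - 1)
    (hw' : QRep.armHeight n (q w) w = q w) {s : ℕ} (hs : s + 4 ≤ 2 * n) :
    sliceElt k hw' s ≠ 0 := by
  intro h
  have h1 := congrArg Subtype.val (congrFun h w)
  unfold sliceElt at h1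
  rw [inj_same] at h1
  exact QRep.chainElt_ne_zero hw hn hs (congrFun h1 [])

lemma exists_mem_radPowSet (hL : IsLabel P n v q) (hher : Hereditary A) (hn : 4 ≤ n)
    {w : Fin n} (hw : w.val = n - 1)
    (hw' : QRep.armHeight n (q w) w = q w) (m : ℕ) : ∀ s, s + m + 4 ≤ 2 * n →
    ∃ g ∈ radPowSet A m (hL.slice hher (QRep.chain k (QRep.armHeight n (q w)) s))
      (hL.slice hher (QRep.chain k (QRep.armHeight n (q w)) (s + m))),
      g.hom (sliceElt k hw' s) = sliceElt k hw' (s + m) := by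
  induction m with
  | zero => exact fun s _ => ⟨𝟙 _, trivial, rfl⟩
  | succ m ih =>
    intro s hs
    have ha := hL.le w
    have hq := hL.height
    have hle := QRep.armHeight_le hq hn hw ha
    have hg := QRep.isHom_chainMap (k := k) hn ha s
    obtain ⟨g, hgm, hge⟩ := ih (s + 1) (by omega)
    rw [show s + (m + 1) = s + 1 + m by omega]
    refine ⟨hL.sliceMap hher hg ≫ g, ⟨_, _, _, hL.finite_slice hher _, ?_, hgm, rfl⟩, ?_⟩
    · exact mem_radSet_of_forall_eq_zero _ (hL.slice_hom_eq_zero hher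
        (QRep.isHeight_armHeight hq hn ha) (fun i => (hle i).1) (fun i => (hle i).2)
        (QRep.chain_hom_eq_zero hn ha s))
    · refine Eq.trans (congrArg g.hom ?_) hge
      refine (sliceLin_inj hg w _).trans (congrArg (inj _ q w) (Subtype.ext ?_))
      refine (hg.compLeft_lift ⟨_, ⟨_, rfl⟩, rfl⟩).trans ?_
      rw [QRep.chainMap_elt hw hn (by omega)]

/-- The lower bound on the nilpotency index. -/
theorem le_of_radVanishes (hL : IsLabel P n v q) (hher : Hereditary A) (hn : 4 ≤ n) {l : ℕ}
    (h : RadVanishes A l) : 2 * n - 3 ≤ l := by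
  by_contra hl
  have ha : ∀ w, n ≤ q w := hL.le
  let w : Fin n := ⟨n - 1, by omega⟩
  have hw : QRep.armHeight n (q w) w = q w := by
    have h1 := QRep.armHeight_spec (q w) w
    have h2 : w.val = n - 1 := rfl
    omega
  obtain ⟨g, hg, hge⟩ := hL.exists_mem_radPowSet hher hn rfl hw l 0 (by omega)
  have h0 := h _ _ (hL.finite_slice hher _) (hL.finite_slice hher _) g hg
  rw [h0] at hge
  exact sliceElt_ne_zero (k := k) hn rfl hw (s := 0 + l) (by omega) hge.symm

end IsLabel

/-- Theorem (Zacharia): if `H = kQ` is a representation-finite hereditary algebra whose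
underlying graph is the Dynkin diagram `D_n` (`n ≥ 4`), then the nilpotency index of the
radical of `mod H` equals `2n - 3`. -/
theorem nilpotency_index_hereditary_typeD (k A : Type) [Field k] [IsAlgClosed k] [Ring A] [Algebra k A]
    [FiniteDimensional k A] (V E : Type) [Fintype V] [Fintype E]
    (P : QuiverPresentation k A V E) (hadm : P.Admissible) (hmin : P.Minimal)
    (hher : Hereditary A) (hrf : RepFinite A)
    (n : ℕ) (hn : 4 ≤ n) (hgraph : P.GraphSpec n (n - 1) (typeDEnds n)) :
    NilpotencyIndex A (2 * n - 3) := by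
  obtain ⟨v, q, hL⟩ := exists_isLabel P hn hgraph
  exact ⟨by omega, hL.radVanishes hn, fun l hl => hL.le_of_radVanishes hher hn hl⟩
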